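/- arXiv:0801.3383 — 10 statements merged into one kernel-verified Lean document; each statement's English description precedes it below -/
import Mathlib

section
/- Let k be a field and V a finite-dimensional k-vector space of dimension n ≥ 1. Let f be a nonzero element of 𝒱·𝒱 (a homogeneous quadratic element of T(V)) and set R := span_k{f}. Then for every m ≥ 0, the sublattice of the lattice of k-submodules of T(V) generated by the submodules 𝒱^i · R · 𝒱^j with i + 2 + j = m is distributive: every triple (E, F, G) of submodules in this sublattice satisfies E ⊓ (F ⊔ G) = (E ⊓ F) ⊔ (E ⊓ G). (Gerasimov's theorem for N = 2.) -/
/-- The degree-one part of the tensor algebra: the range of the canonical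
inclusion `ι : V → T(V)`, as a `k`-submodule of `T(V)`. -/
noncomputable def degreeOne (k : Type*) [CommSemiring k] (V : Type*) [AddCommMonoid V]
    [Module k V] : Submodule k (TensorAlgebra k V) :=
  LinearMap.range (TensorAlgebra.ι k : V →ₗ[k] TensorAlgebra k V)

/-- Membership in the sublattice generated by a set `S` of elements of a lattice:
the smallest collection containing `S` and closed under `⊓` and `⊔`. -/
inductive InSublattice {α : Type*} [Lattice α] (S : Set α) : α → Prop
  | base {x : α} : x ∈ S → InSublattice S x
  | inf {x y : α} : InSublattice S x → InSublattice S y → InSublattice S (x ⊓ y)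
  | sup {x y : α} : InSublattice S x → InSublattice S y → InSublattice S (x ⊔ y)

theorem span_image_inter {k M J : Type*} [Ring k] [AddCommGroup M] [Module k M]
    {B : J → M} (hB : LinearIndependent k B) (A A' : Set J) :
    Submodule.span k (B '' (A ∩ A')) = Submodule.span k (B '' A) ⊓ Submodule.span k (B '' A') := by
  simp only [Finsupp.span_image_eq_map_linearCombination, Finsupp.supported_inter]
  exact Submodule.map_inf _ hB

/-- Submodules spanned by subsets of one linearly independent family generate a distributive
lattice. -/
theorem InSublattice.inf_sup_of_linearIndependent {k M J : Type*} [Ring k] [AddCommGroup M]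
    [Module k M] {B : J → M} (hB : LinearIndependent k B) {S : Set (Submodule k M)}
    (hS : ∀ P ∈ S, ∃ A : Set J, P = Submodule.span k (B '' A)) {E F G : Submodule k M}
    (hE : InSublattice S E) (hF : InSublattice S F) (hG : InSublattice S G) :
    E ⊓ (F ⊔ G) = (E ⊓ F) ⊔ (E ⊓ G) := by
  have key : ∀ {P}, InSublattice S P → ∃ A : Set J, P = Submodule.span k (B '' A) := by
    intro P hP
    induction hP with
    | base h => exact hS _ h
    | inf _ _ h₁ h₂ =>
      obtain ⟨A₁, rfl⟩ := h₁
      obtain ⟨A₂, rfl⟩ := h₂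
      exact ⟨A₁ ∩ A₂, (span_image_inter hB _ _).symm⟩
    | sup _ _ h₁ h₂ =>
      obtain ⟨A₁, rfl⟩ := h₁
      obtain ⟨A₂, rfl⟩ := h₂
      exact ⟨A₁ ∪ A₂, by rw [Set.image_union, Submodule.span_union]⟩
  obtain ⟨A, rfl⟩ := key hE
  obtain ⟨A', rfl⟩ := key hF
  obtain ⟨A'', rfl⟩ := key hG
  simp only [← span_image_inter hB, ← Submodule.span_union, ← Set.image_union]
  rw [Set.inter_union_distrib_left]

section Words

variable {k V κ : Type*} [Field k] [AddCommGroup V] [Module k V]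

theorem span_range_ι_basis (b : Module.Basis κ k V) :
    Submodule.span k (Set.range fun a => TensorAlgebra.ι k (b a)) = degreeOne k V := by
  rw [degreeOne, LinearMap.range_eq_map, ← b.span_eq, Submodule.map_span, ← Set.range_comp]
  rfl

/-- The words of length `m` in a basis span the `m`-th tensor power. -/
theorem span_words (b : Module.Basis κ k V) (m : ℕ) :
    Submodule.span k ((fun w : List κ => (w.map fun a => TensorAlgebra.ι k (b a)).prod) ''
      {w | w.length = m}) = degreeOne k V ^ m := by
  induction m with
  | zero => simp [List.length_eq_zero_iff, Submodule.one_eq_span]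
  | succ m ih =>
    rw [pow_succ', ← ih, ← span_range_ι_basis b, Submodule.span_mul_span]
    congr 1
    ext z
    simp only [Set.mem_image, Set.mem_mul, Set.mem_ofPred_eq, Set.mem_range]
    constructor
    · rintro ⟨w, hw, rfl⟩
      obtain _ | ⟨a, w⟩ := w
      · simp at hw
      · exact ⟨_, ⟨a, rfl⟩, _, ⟨w, by simpa using hw, rfl⟩, by simp⟩
    · rintro ⟨_, ⟨a, rfl⟩, _, ⟨w, hw, rfl⟩, rfl⟩
      exact ⟨a :: w, by simp [hw], by simp⟩

theorem linearIndependent_words (b : Module.Basis κ k V) :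
    LinearIndependent k fun w : List κ => (w.map fun a => TensorAlgebra.ι k (b a)).prod := by
  have h : (fun w : FreeMonoid κ => (w.toList.map fun a => TensorAlgebra.ι k (b a)).prod) =
      b.tensorAlgebra := by
    ext w
    simp [Module.Basis.tensorAlgebra, FreeAlgebra.basisFreeMonoid,
      FreeAlgebra.equivMonoidAlgebraFreeMonoid, FreeMonoid.lift_apply, map_list_prod,
      Function.comp_def]
  have h' := b.tensorAlgebra.linearIndependent
  rw [← h] at h'
  exact h'

theorem finrank_degreeOne_pow [FiniteDimensional k V] (m : ℕ) :
    Module.finrank k ↥(degreeOne k V ^ m) = Module.finrank k V ^ m := by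
  let b := Module.finBasis k V
  have h : LinearIndependent k fun w : List.Vector (Fin (Module.finrank k V)) m =>
      (w.1.map fun a => TensorAlgebra.ι k (b a)).prod :=
    (linearIndependent_words b).comp _ Subtype.val_injective
  have h₂ := finrank_span_eq_card h
  rw [card_vector, Fintype.card_fin] at h₂
  rw [← h₂, ← span_words b m, Set.image_eq_range]
  rfl

theorem linearIndependent_of_span_eq [FiniteDimensional k V] [Fintype κ]
    (hκ : Fintype.card κ = Module.finrank k V) (m : ℕ) {B : List κ → TensorAlgebra k V}
    (hB : Submodule.span k (B '' {w | w.length = m}) = degreeOne k V ^ m) :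
    LinearIndependent k fun w : List.Vector κ m => B w.1 := by
  rw [linearIndependent_iff_card_eq_finrank_span, card_vector, hκ, ← finrank_degreeOne_pow,
    ← hB, Set.finrank, Set.image_eq_range]
  rfl

/-- Distributivity from a family of words adapted to the relation `g`. -/
theorem distributive_of_adapted [FiniteDimensional k V] [Fintype κ]
    (hκ : Fintype.card κ = Module.finrank k V) {g : TensorAlgebra k V}
    {B : ℕ → List κ → TensorAlgebra k V} {s t : κ}
    (hspan : ∀ p m, Submodule.span k (B p '' {w | w.length = m}) = degreeOne k V ^ m)
    (hmul : ∀ p u v, B p (u ++ s :: t :: v) = B p u * g * B (p + u.length + 2) v)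
    {m : ℕ} {S : Set (Submodule k (TensorAlgebra k V))}
    (hS : S = {P | ∃ i j : ℕ, i + 2 + j = m ∧
        P = (degreeOne k V) ^ i * Submodule.span k {g} * (degreeOne k V) ^ j})
    {E F G : Submodule k (TensorAlgebra k V)}
    (hE : InSublattice S E) (hF : InSublattice S F) (hG : InSublattice S G) :
    E ⊓ (F ⊔ G) = (E ⊓ F) ⊔ (E ⊓ G) := by
  refine InSublattice.inf_sup_of_linearIndependent
    (linearIndependent_of_span_eq hκ m (hspan 0 m)) ?_ hE hF hG
  subst hS
  rintro P ⟨i, j, rfl, rfl⟩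
  refine ⟨{w | ∃ u v, u.length = i ∧ v.length = j ∧ w.1 = u ++ s :: t :: v}, ?_⟩
  rw [← hspan 0 i, ← hspan (i + 2) j, Submodule.span_mul_span, Submodule.span_mul_span]
  congr 1
  ext z
  simp only [Set.mem_image, Set.mem_mul, Set.mem_ofPred_eq, Set.mem_singleton_iff]
  constructor
  · rintro ⟨_, ⟨_, ⟨u, hu, rfl⟩, _, rfl, rfl⟩, _, ⟨v, hv, rfl⟩, rfl⟩
    exact ⟨⟨u ++ s :: t :: v, by simp [hu, hv]; omega⟩, ⟨u, v, hu, hv, rfl⟩, by simp [hmul, hu]⟩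
  · rintro ⟨w, ⟨u, v, hu, hv, hw⟩, rfl⟩
    exact ⟨_, ⟨_, ⟨u, hu, rfl⟩, g, rfl, rfl⟩, _, ⟨v, hv, rfl⟩, by rw [hw, hmul, hu, zero_add]⟩

/-- Words at position `p` in the letters `x p`, with each factor `s t` replaced by `f`. -/
def substWord [DecidableEq κ] (f : TensorAlgebra k V) (x : ℕ → κ → TensorAlgebra k V) (s t : κ) :
    ℕ → List κ → TensorAlgebra k V
  | _, [] => 1
  | p, [a] => x p a
  | p, a :: c :: l =>
    if a = s ∧ c = t then f * substWord f x s t (p + 2) l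
    else x p a * substWord f x s t (p + 1) (c :: l)

variable [DecidableEq κ] {f : TensorAlgebra k V} {x : ℕ → κ → TensorAlgebra k V} {s t : κ}

theorem substWord_append (hst : s ≠ t) (p : ℕ) (u v : List κ) :
    substWord f x s t p (u ++ s :: t :: v) =
      substWord f x s t p u * f * substWord f x s t (p + u.length + 2) v := by
  match u with
  | [] => simp [substWord]
  | [a] => simp [substWord, hst, mul_assoc, add_assoc, add_comm 1 2]
  | a :: c :: u =>
    have h₁ := substWord_append hst (p + 2) u v
    have h₂ := substWord_append hst (p + 1) (c :: u) v
    simp only [List.cons_append, substWord, List.length_cons] at h₁ h₂ ⊢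
    split_ifs
    · rw [h₁, show p + 2 + u.length + 2 = p + (u.length + 1 + 1) + 2 by omega]
      simp only [mul_assoc]
    · rw [h₂, show p + 1 + (u.length + 1) + 2 = p + (u.length + 1 + 1) + 2 by omega]
      simp only [mul_assoc]

theorem substWord_cons_of_ne {a : κ} (ha : a ≠ s) (p : ℕ) (l : List κ) :
    substWord f x s t p (a :: l) = x p a * substWord f x s t (p + 1) l := by
  cases l <;> simp [substWord, ha]

theorem substWord_cons_of_head {c : κ} (hc : c ≠ t) (a : κ) (p : ℕ) (l : List κ) :
    substWord f x s t p (a :: c :: l) = x p a * substWord f x s t (p + 1) (c :: l) := by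
  simp [substWord, hc]

theorem substWord_mem (hf : f ∈ degreeOne k V * degreeOne k V)
    (hx : ∀ p a, x p a ∈ degreeOne k V) (p : ℕ) (w : List κ) :
    substWord f x s t p w ∈ degreeOne k V ^ w.length := by
  match w with
  | [] => simp [substWord]
  | [a] => simpa [substWord] using hx p a
  | a :: c :: l =>
    have h₁ := substWord_mem hf hx (p + 2) l
    have h₂ := substWord_mem hf hx (p + 1) (c :: l)
    simp only [substWord]
    split_ifs
    · rw [List.length_cons, List.length_cons, pow_succ', pow_succ', ← mul_assoc]
      exact Submodule.mul_mem_mul hf h₁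
    · rw [List.length_cons, pow_succ']
      exact Submodule.mul_mem_mul (hx p a) h₂

theorem span_substWord [Fintype κ] (hst : s ≠ t)
    (hx : ∀ p, Submodule.span k (Set.range (x p)) = degreeOne k V)
    (hf : f ∈ degreeOne k V * degreeOne k V)
    (hlead : ∀ p, ∃ z : κ → TensorAlgebra k V, (∀ a, z a ∈ degreeOne k V) ∧
      f = x p s * x (p + 1) t + ∑ a ∈ Finset.univ.erase s, x p a * z a) (p m : ℕ) :
    Submodule.span k (substWord f x s t p '' {w | w.length = m}) = degreeOne k V ^ m := by
  have hxmem : ∀ p a, x p a ∈ degreeOne k V := fun p a =>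
    hx p ▸ Submodule.subset_span ⟨a, rfl⟩
  apply le_antisymm
  · rw [Submodule.span_le]
    rintro _ ⟨w, rfl, rfl⟩
    exact substWord_mem hf hxmem p w
  induction m generalizing p with
  | zero => simp [List.length_eq_zero_iff, Submodule.one_eq_span, substWord]
  | succ m ih =>
    have hne : ∀ a ≠ s, ∀ y ∈ degreeOne k V ^ m,
        x p a * y ∈ Submodule.span k (substWord f x s t p '' {w | w.length = m + 1}) := by
      intro a ha y hy
      have hle : Submodule.span k (substWord f x s t (p + 1) '' {w | w.length = m}) ≤
          (Submodule.span k (substWord f x s t p '' {w | w.length = m + 1})).comap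
            (LinearMap.mulLeft k (x p a)) := by
        rw [Submodule.span_le]
        rintro _ ⟨l, rfl, rfl⟩
        exact Submodule.subset_span ⟨a :: l, rfl, substWord_cons_of_ne ha p l⟩
      exact hle (ih (p + 1) hy)
    rw [pow_succ']
    refine le_trans (mul_le_mul' (hx p).ge (ih (p + 1))) ?_
    rw [Submodule.span_mul_span, Submodule.span_le]
    rintro _ ⟨_, ⟨a, rfl⟩, _, ⟨l, rfl, rfl⟩, rfl⟩
    have hl := substWord_mem (s := s) (t := t) hf hxmem (p + 1) l
    by_cases ha : a = s
    swap
    · exact hne a ha _ hl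
    subst ha
    obtain _ | ⟨c, l⟩ := l
    · exact Submodule.subset_span ⟨[a], rfl, by simp [substWord]⟩
    by_cases hc : c = t
    swap
    · exact Submodule.subset_span ⟨a :: c :: l, rfl, substWord_cons_of_head hc a p l⟩
    subst hc
    obtain ⟨z, hz, hfz⟩ := hlead p
    have hexp : x p a * substWord f x a c (p + 1) (c :: l) =
        substWord f x a c p (a :: c :: l) -
          ∑ d ∈ Finset.univ.erase a, x p d * (z d * substWord f x a c (p + 2) l) := by
      rw [substWord_cons_of_ne hst.symm, substWord, if_pos ⟨rfl, rfl⟩, eq_sub_iff_add_eq]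
      conv_rhs => arg 1; rw [hfz]
      simp only [add_mul, Finset.sum_mul, mul_assoc]
    simp only [hexp]
    refine Submodule.sub_mem _ (Submodule.subset_span ⟨_, rfl, rfl⟩)
      (Submodule.sum_mem _ fun d hd => hne d (Finset.ne_of_mem_erase hd) _ ?_)
    rw [List.length_cons, pow_succ']
    exact Submodule.mul_mem_mul (hz d) (substWord_mem hf hxmem _ l)

end Words

section Bases

variable {k V : Type*} [Field k] [AddCommGroup V] [Module k V]

/-- A basis of the kernel of `ξ` extends by any `w` with `ξ w = 1` to a basis of `V` whose zeroth
coordinate is `ξ`. -/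
theorem exists_basis_cons {d : ℕ} {ξ : Module.Dual k V} {w : V} (hw : ξ w = 1)
    (b : Module.Basis (Fin d) k (LinearMap.ker ξ)) :
    ∃ b' : Module.Basis (Fin (d + 1)) k V,
      b' 0 = w ∧ (∀ i : Fin d, b' i.succ = b i) ∧ b'.coord 0 = ξ := by
  let b' : Module.Basis (Fin (d + 1)) k V := .mkFinCons w b
    (fun c x hx h => by
      have := congrArg ξ h
      simpa [hw, LinearMap.mem_ker.1 hx] using this)
    (fun z => ⟨-ξ z, by simp [hw]⟩)
  have hb' : ⇑b' = Fin.cons w ((↑) ∘ b) := Module.Basis.coe_mkFinCons ..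
  refine ⟨b', by simp [hb'], by simp [hb'], b'.ext fun i => ?_⟩
  refine Fin.cases ?_ (fun i => ?_) i
  · rw [Module.Basis.coord_apply, b'.repr_self]
    simp [hb', hw]
  · rw [Module.Basis.coord_apply, b'.repr_self]
    have hbi : ξ (b i) = 0 := (b i).2
    simp [hb', hbi]

theorem exists_basis_zero_eq {d : ℕ} [FiniteDimensional k V]
    (hd : Module.finrank k V = d + 1) {w : V} (hw : w ≠ 0) :
    ∃ b : Module.Basis (Fin (d + 1)) k V, b 0 = w := by
  obtain ⟨ξ, hξ⟩ : ∃ ξ : Module.Dual k V, ξ w = 1 := by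
    obtain ⟨ξ, hξ⟩ := not_forall.1 (mt (Module.forall_dual_apply_eq_zero_iff k w).1 hw)
    exact ⟨(ξ w)⁻¹ • ξ, by simp [hξ]⟩
  have hξ0 : ξ ≠ 0 := by rintro rfl; simp at hξ
  have hker := Module.Dual.finrank_ker_add_one_of_ne_zero hξ0
  obtain ⟨b, hb, -⟩ := exists_basis_cons hξ
    (Module.finBasisOfFinrankEq k (LinearMap.ker ξ) (n := d) (by omega))
  exact ⟨b, hb⟩

theorem exists_basis_coord_eq {d : ℕ} [FiniteDimensional k V]
    (hd : Module.finrank k V = d + 2) {w : V} (hw : w ≠ 0) {ξ : Module.Dual k V} (hξ : ξ ≠ 0)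
    (hξw : ξ w = 0) :
    ∃ b : Module.Basis (Fin (d + 2)) k V, b.coord 0 = ξ ∧ b 1 = w := by
  have hker := Module.Dual.finrank_ker_add_one_of_ne_zero hξ
  obtain ⟨b, hb⟩ := exists_basis_zero_eq (k := k) (V := LinearMap.ker ξ) (d := d) (by omega)
    (w := ⟨w, hξw⟩) (fun h => hw (congrArg Subtype.val h))
  obtain ⟨y, hy⟩ : ∃ y, ξ y = 1 := by
    obtain ⟨y, hy⟩ := DFunLike.ne_iff.1 hξ
    exact ⟨(ξ y)⁻¹ • y, by simp [show ξ y ≠ 0 from hy]⟩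
  obtain ⟨b', -, h₁, h₂⟩ := exists_basis_cons hy b
  exact ⟨b', h₂, by simpa [hb] using h₁ 0⟩

/-- A quadratic element of the tensor algebra is a contraction `c : V* → V`, expanded uniformly in
every basis. -/
theorem exists_contraction {f : TensorAlgebra k V} (hf : f ∈ degreeOne k V * degreeOne k V) :
    ∃ c : Module.Dual k V →ₗ[k] V, ∀ (n : ℕ) (b : Module.Basis (Fin n) k V),
      f = ∑ a, TensorAlgebra.ι k (b a) * TensorAlgebra.ι k (c (b.coord a)) := by
  induction hf using Submodule.mul_induction_on' with
  | mem_mul_mem x hx y hy =>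
    obtain ⟨v, rfl⟩ := hx
    obtain ⟨w, rfl⟩ := hy
    refine ⟨(Module.Dual.eval k V v).smulRight w, fun n b => ?_⟩
    conv_lhs => rw [← b.sum_repr v, map_sum, Finset.sum_mul]
    simp
  | add x _ y _ hx hy =>
    obtain ⟨c, hc⟩ := hx
    obtain ⟨c', hc'⟩ := hy
    refine ⟨c + c', fun n b => ?_⟩
    conv_lhs => rw [hc n b, hc' n b]
    simp [mul_add, Finset.sum_add_distrib]

end Bases

/-- **Gerasimov's theorem for `N = 2`.** A quadratic algebra on a finite-dimensional
space of generators with a single relation is distributive. -/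
theorem gerasimov_distributive_quadratic
    {k : Type*} [Field k] {V : Type*} [AddCommGroup V] [Module k V]
    [FiniteDimensional k V] (hn : 1 ≤ Module.finrank k V)
    (f : TensorAlgebra k V) (hf0 : f ≠ 0) (hf2 : f ∈ degreeOne k V * degreeOne k V)
    (R : Submodule k (TensorAlgebra k V)) (hR : R = Submodule.span k {f})
    (m : ℕ)
    (S : Set (Submodule k (TensorAlgebra k V)))
    (hS : S = {P | ∃ i j : ℕ, i + 2 + j = m ∧
        P = (degreeOne k V) ^ i * R * (degreeOne k V) ^ j})
    (E F G : Submodule k (TensorAlgebra k V))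
    (hE : InSublattice S E) (hF : InSublattice S F) (hG : InSublattice S G) :
    E ⊓ (F ⊔ G) = (E ⊓ F) ⊔ (E ⊓ G) := by
  obtain ⟨c, hc⟩ := exists_contraction hf2
  obtain ⟨ξ₀, hξ₀⟩ : ∃ ξ, c ξ ≠ 0 := by
    by_contra! h
    exact hf0 (by simpa [h] using hc _ (Module.finBasis k V))
  by_cases hstep : ∀ ξ, c ξ ≠ 0 → ∃ ξ', ξ' (c ξ) = 0 ∧ c ξ' ≠ 0
  · choose! next hnext₁ hnext₂ using hstep
    let ξ : ℕ → Module.Dual k V := fun p => next^[p] ξ₀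
    have hξ : ∀ p, c (ξ p) ≠ 0 := by
      intro p
      induction p with
      | zero => exact hξ₀
      | succ p ih => simpa only [ξ, Function.iterate_succ_apply'] using hnext₂ _ ih
    have hξ' : ∀ p, ξ (p + 1) (c (ξ p)) = 0 := fun p => by
      simpa only [ξ, Function.iterate_succ_apply'] using hnext₁ _ (hξ p)
    have hξ0 : ∀ p, ξ p ≠ 0 := fun p h => hξ p (by simp [h])
    obtain ⟨d, hd⟩ : ∃ d, Module.finrank k V = d + 2 := by
      refine ⟨Module.finrank k V - 2, ?_⟩
      have hker := Module.Dual.finrank_ker_add_one_of_ne_zero (hξ0 1)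
      have : 0 < Module.finrank k (LinearMap.ker (ξ 1)) :=
        Module.finrank_pos_iff_exists_ne_zero.2 ⟨⟨c (ξ 0), hξ' 0⟩, fun h => hξ 0 (congrArg Subtype.val h)⟩
      omega
    choose b hb₁ hb₂ using fun p => exists_basis_coord_eq hd (hξ p) (hξ0 (p + 1)) (hξ' p)
    refine distributive_of_adapted (κ := Fin (d + 2)) (by simp [hd])
      (span_substWord (x := fun p a => TensorAlgebra.ι k (b p a)) (s := 0) (t := 1) (by simp)
        (fun p => span_range_ι_basis (b p)) hf2 fun p => ?_)
      (substWord_append (by simp)) (hR ▸ hS) hE hF hG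
    refine ⟨fun a => TensorAlgebra.ι k (c ((b p).coord a)), fun a => ⟨_, rfl⟩, ?_⟩
    rw [hb₂, ← hb₁, Finset.add_sum_erase _
      (fun a => TensorAlgebra.ι k (b p a) * TensorAlgebra.ι k (c ((b p).coord a)))
      (Finset.mem_univ 0)]
    exact hc _ (b p)
  · push Not at hstep
    obtain ⟨ξ, hξ, hker⟩ := hstep
    obtain ⟨d, hd⟩ : ∃ d, Module.finrank k V = d + 1 := ⟨_, (Nat.sub_add_cancel hn).symm⟩
    obtain ⟨b, hb⟩ := exists_basis_zero_eq hd hξ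
    set g := TensorAlgebra.ι k (b 0) * TensorAlgebra.ι k (b 0) with hg
    have hfg : ∃ r : k, f = r • g := by
      have hcξ : ∀ a ≠ 0, c (b.coord a) = 0 := fun a ha =>
        hker _ (by simp [← hb, ha.symm])
      have hξ0 : c ξ = ξ (b 0) • c (b.coord 0) := by
        have : ξ = ∑ a, ξ (b a) • b.coord a := b.ext fun i => by simp
        conv_lhs => rw [this]
        rw [map_sum, Finset.sum_eq_single 0] <;> simp +contextual [hcξ]
      have hne : ξ (b 0) ≠ 0 := fun h => hξ (by simp [hξ0, h])
      refine ⟨(ξ (b 0))⁻¹, ?_⟩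
      rw [hc _ b, Finset.sum_eq_single 0 (fun a _ ha => by simp [hcξ a ha]) (by simp), hg]
      have : c (b.coord 0) = (ξ (b 0))⁻¹ • b 0 := by
        rw [eq_inv_smul_iff₀ hne, ← hξ0, hb]
      rw [this, map_smul, mul_smul_comm]
    obtain ⟨r, hr⟩ := hfg
    have hr0 : r ≠ 0 := by rintro rfl; simp [hr] at hf0
    have hRg : R = Submodule.span k {g} := by
      rw [hR, hr, Submodule.span_singleton_smul_eq (IsUnit.mk0 r hr0)]
    exact distributive_of_adapted (κ := Fin (d + 1)) (s := 0) (t := 0) (by simp [hd])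
      (B := fun _ w => (w.map fun a => TensorAlgebra.ι k (b a)).prod)
      (fun _ m => span_words b m) (fun _ u v => by simp [hg, mul_assoc]) (hRg ▸ hS) hE hF hG
end

section
/- Let k be a field, V a k-vector space, N ≥ 2, and f a nonzero element of 𝒱^N; set R := span_k{f}. Then the following two conditions are equivalent: (i) for every m with 2 ≤ m ≤ N−1, (R · 𝒱^m) ⊓ (𝒱^m · R) ≤ 𝒱^{m−1} · R · 𝒱; (ii) for every m with 2 ≤ m ≤ N−1, (R · 𝒱^m) ⊓ (𝒱^m · R) = ⨅_{i+j=m} 𝒱^i · R · 𝒱^j (the infimum over all pairs (i, j) of natural numbers with i + j = m). -/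
/-- The algebra map sending `v` to the matrix `!![ι v, φ v; 0, 0]`. Its upper right entry
strips a last factor `v` off a tensor and replaces it by the scalar `φ v`. -/
noncomputable def lastFactorMatrix {k V : Type*} [CommRing k] [AddCommGroup V] [Module k V]
    (φ : V →ₗ[k] k) :
    TensorAlgebra k V →ₐ[k] Matrix (Fin 2) (Fin 2) (TensorAlgebra k V) :=
  TensorAlgebra.lift k
    { toFun := fun v => !![TensorAlgebra.ι k v, algebraMap k _ (φ v); 0, 0]
      map_add' := fun v w => by
        ext i j
        fin_cases i <;> fin_cases j <;> simp
      map_smul' := fun c v => by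
        ext i j
        fin_cases i <;> fin_cases j <;> simp [Algebra.smul_def] }

section CommRing

variable {k V : Type*} [CommRing k] [AddCommGroup V] [Module k V]

theorem lastFactorMatrix_ι (φ : V →ₗ[k] k) (v : V) :
    lastFactorMatrix φ (TensorAlgebra.ι k v) =
      !![TensorAlgebra.ι k v, algebraMap k _ (φ v); 0, 0] := by
  simp [lastFactorMatrix]

theorem lastFactorMatrix_first_column (φ : V →ₗ[k] k) (t : TensorAlgebra k V) :
    lastFactorMatrix φ t 0 0 = t ∧ lastFactorMatrix φ t 1 0 = 0 := by
  induction t using TensorAlgebra.induction with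
  | algebraMap r => simp [AlgHom.commutes, Matrix.algebraMap_matrix_apply]
  | ι v => simp [lastFactorMatrix_ι]
  | mul a b ha hb => simp [Matrix.mul_apply, Fin.sum_univ_two, ha, hb]
  | add a b ha hb => simp [ha, hb]

theorem lastFactorMatrix_mul_ι (φ : V →ₗ[k] k) (t : TensorAlgebra k V) (v : V) :
    lastFactorMatrix φ (t * TensorAlgebra.ι k v) 0 1 = φ v • t := by
  simp [Matrix.mul_apply, Fin.sum_univ_two, lastFactorMatrix_ι,
    (lastFactorMatrix_first_column φ t).1, Algebra.smul_def, Algebra.commutes]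

theorem lastFactorMatrix_mem {A : Submodule k (TensorAlgebra k V)} (φ : V →ₗ[k] k)
    {x : TensorAlgebra k V} (hx : x ∈ A * degreeOne k V) :
    lastFactorMatrix φ x 0 1 ∈ A := by
  induction hx using Submodule.mul_induction_on' with
  | mem_mul_mem a ha w hw =>
    obtain ⟨v, rfl⟩ := hw
    rw [lastFactorMatrix_mul_ι]
    exact A.smul_mem _ ha
  | add x _ y _ hx hy =>
    rw [map_add]
    exact A.add_mem hx hy

theorem exists_eq_sum_lastFactorMatrix {κ : Type*} (b : Module.Basis κ k V)
    {A : Submodule k (TensorAlgebra k V)} {x : TensorAlgebra k V}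
    (hx : x ∈ A * degreeOne k V) :
    ∃ s : Finset κ, ∀ t, s ⊆ t →
      ∑ i ∈ t, lastFactorMatrix (b.coord i) x 0 1 * TensorAlgebra.ι k (b i) = x := by
  classical
  induction hx using Submodule.mul_induction_on' with
  | mem_mul_mem a ha w hw =>
    obtain ⟨v, rfl⟩ := hw
    refine ⟨(b.repr v).support, fun t ht => ?_⟩
    have hv : ∑ i ∈ t, b.repr v i • b i = v := by
      conv_rhs => rw [← b.linearCombination_repr v, Finsupp.linearCombination_apply]
      exact (Finsupp.sum_of_support_subset _ ht (fun i a => a • b i) fun _ _ => zero_smul k _).symm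
    conv_rhs => rw [← hv]
    simp [lastFactorMatrix_mul_ι, Finset.mul_sum]
  | add x _ y _ hx hy =>
    obtain ⟨s, hs⟩ := hx
    obtain ⟨s', hs'⟩ := hy
    refine ⟨s ∪ s', fun t ht => ?_⟩
    simp only [map_add, Matrix.add_apply, add_mul, Finset.sum_add_distrib]
    rw [hs t (Finset.union_subset_left ht), hs' t (Finset.union_subset_right ht)]

end CommRing

section Field

variable {k V : Type*} [Field k] [AddCommGroup V] [Module k V]

theorem inf_mul_degreeOne (A B : Submodule k (TensorAlgebra k V)) :
    A * degreeOne k V ⊓ B * degreeOne k V ≤ (A ⊓ B) * degreeOne k V := by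
  rintro x ⟨hA, hB⟩
  obtain ⟨s, hs⟩ := exists_eq_sum_lastFactorMatrix (Module.Basis.ofVectorSpace k V) hA
  rw [← hs s subset_rfl]
  exact Submodule.sum_mem _ fun i _ => Submodule.mul_mem_mul
    ⟨lastFactorMatrix_mem _ hA, lastFactorMatrix_mem _ hB⟩ ⟨_, rfl⟩

theorem inf_le_pow_mul_mul_pow_of_extra_condition (R : Submodule k (TensorAlgebra k V)) (M : ℕ)
    (h : ∀ m : ℕ, 2 ≤ m → m ≤ M →
      R * (degreeOne k V) ^ m ⊓ (degreeOne k V) ^ m * R ≤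
        (degreeOne k V) ^ (m - 1) * R * degreeOne k V) (i j : ℕ) (hij : i + j ≤ M) :
    R * (degreeOne k V) ^ (i + j) ⊓ (degreeOne k V) ^ (i + j) * R ≤
      (degreeOne k V) ^ i * R * (degreeOne k V) ^ j := by
  induction j with
  | zero => simp
  | succ j ih =>
    rcases Nat.eq_zero_or_pos i with rfl | hi
    · simp
    · calc
        _ ≤ R * (degreeOne k V) ^ (i + j) * degreeOne k V ⊓
              (degreeOne k V) ^ (i + j) * R * degreeOne k V := by
          refine le_inf (inf_le_left.trans ?_) (h _ (by omega) hij)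
          rw [← add_assoc, pow_succ, mul_assoc]
        _ ≤ _ := inf_mul_degreeOne _ _
        _ ≤ (degreeOne k V) ^ i * R * (degreeOne k V) ^ j * degreeOne k V :=
          mul_le_mul_left (ih (by omega)) _
        _ = _ := by rw [pow_succ, mul_assoc _ (degreeOne k V ^ j)]

end Field

/-- For a one-dimensional relation space `R = span {f}` with `f` a nonzero element of
`𝒱^N`, the "extra condition" `(R·𝒱^m) ⊓ (𝒱^m·R) ≤ 𝒱^{m-1}·R·𝒱` for `2 ≤ m ≤ N-1` is
equivalent to the equalities `(R·𝒱^m) ⊓ (𝒱^m·R) = ⨅_{i+j=m} 𝒱^i·R·𝒱^j`. -/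
theorem single_relation_extra_condition_iff
    {k : Type*} [Field k] {V : Type*} [AddCommGroup V] [Module k V]
    (N : ℕ) (hN : 2 ≤ N)
    (f : TensorAlgebra k V) (hf0 : f ≠ 0) (hfN : f ∈ (degreeOne k V) ^ N)
    (R : Submodule k (TensorAlgebra k V)) (hR : R = Submodule.span k {f}) :
    (∀ m : ℕ, 2 ≤ m → m ≤ N - 1 →
        R * (degreeOne k V) ^ m ⊓ (degreeOne k V) ^ m * R ≤
          (degreeOne k V) ^ (m - 1) * R * degreeOne k V) ↔
    (∀ m : ℕ, 2 ≤ m → m ≤ N - 1 →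
        R * (degreeOne k V) ^ m ⊓ (degreeOne k V) ^ m * R =
          ⨅ (p : ℕ × ℕ) (_ : p.1 + p.2 = m),
            (degreeOne k V) ^ p.1 * R * (degreeOne k V) ^ p.2) := by
  constructor
  · intro h m _ hm
    apply le_antisymm
    · refine le_iInf₂ fun p hp => ?_
      subst hp
      exact inf_le_pow_mul_mul_pow_of_extra_condition R (N - 1) h p.1 p.2 hm
    · refine le_inf ?_ ?_
      · exact (iInf₂_le (0, m) (zero_add m)).trans (by simp)
      · exact (iInf₂_le (m, 0) (add_zero m)).trans (by simp)
  · intro h m hm hmN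
    rw [h m hm hmN]
    exact (iInf₂_le (m - 1, 1) (Nat.sub_add_cancel (by omega))).trans (by simp)
end

section
/- Let k be a field of characteristic zero and V a finite-dimensional k-vector space of dimension n. Let 2 ≤ N ≤ n and let f ∈ 𝒱^N be a nonzero antisymmetric element; set R := span_k{f}. Then (R · 𝒱^m) ⊓ (𝒱^m · R) = ⊥ for every m with 1 ≤ m ≤ N−1, and consequently ⨅_{p+N+q=m} 𝒱^p · R · 𝒱^q = ⊥ for every m ≥ N+1. -/
/-- The antisymmetriser `Ant(v_1, …, v_r) = Σ_{σ ∈ S_r} sgn(σ) v_{σ(1)} ⋯ v_{σ(r)}`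
inside the tensor algebra. -/
noncomputable def antisymmetriser (k : Type*) [CommRing k] {V : Type*} [AddCommGroup V]
    [Module k V] (r : ℕ) (v : Fin r → V) : TensorAlgebra k V :=
  ∑ σ : Equiv.Perm (Fin r),
    (Equiv.Perm.sign σ : ℤ) • (List.ofFn fun i => TensorAlgebra.ι k (v (σ i))).prod

/-- An element of the tensor algebra is antisymmetric of degree `r` if it lies in the span
of the antisymmetrisers `Ant(v_1, …, v_r)`. -/
def IsAntisymmetric (k : Type*) [CommRing k] {V : Type*} [AddCommGroup V] [Module k V]
    (r : ℕ) (a : TensorAlgebra k V) : Prop :=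
  a ∈ Submodule.span k (Set.range (antisymmetriser k r))

open TensorAlgebra

section Contraction

variable {k : Type*} [Field k] {V : Type*} [AddCommGroup V] [Module k V]

/-- The triangular representation `x ↦ !![x, ∂x; 0, ε x]` of the tensor algebra, in which `∂` is
contraction of the last tensor factor with `φ` and `ε` is the augmentation. -/
noncomputable def contractLastMatrix (φ : Module.Dual k V) :
    TensorAlgebra k V →ₐ[k] Matrix (Fin 2) (Fin 2) (TensorAlgebra k V) :=
  TensorAlgebra.lift k
    { toFun := fun v => !![ι k v, algebraMap k _ (φ v); 0, 0]
      map_add' := fun v w => by ext i j; fin_cases i <;> fin_cases j <;> simp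
      map_smul' := fun c v => by
        ext i j; fin_cases i <;> fin_cases j <;> simp [Algebra.smul_def] }

/-- The triangular representation `x ↦ !![ε x, ∂x; 0, x]` of the tensor algebra, in which `∂` is
contraction of the first tensor factor with `φ` and `ε` is the augmentation. -/
noncomputable def contractFirstMatrix (φ : Module.Dual k V) :
    TensorAlgebra k V →ₐ[k] Matrix (Fin 2) (Fin 2) (TensorAlgebra k V) :=
  TensorAlgebra.lift k
    { toFun := fun v => !![0, algebraMap k _ (φ v); 0, ι k v]
      map_add' := fun v w => by ext i j; fin_cases i <;> fin_cases j <;> simp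
      map_smul' := fun c v => by
        ext i j; fin_cases i <;> fin_cases j <;> simp [Algebra.smul_def] }

/-- Contraction of the last tensor factor with a linear form. -/
noncomputable def contractLast (φ : Module.Dual k V) :
    TensorAlgebra k V →ₗ[k] TensorAlgebra k V :=
  Matrix.entryLinearMap k _ 0 1 ∘ₗ (contractLastMatrix φ).toLinearMap

/-- Contraction of the first tensor factor with a linear form. -/
noncomputable def contractFirst (φ : Module.Dual k V) :
    TensorAlgebra k V →ₗ[k] TensorAlgebra k V :=
  Matrix.entryLinearMap k _ 0 1 ∘ₗ (contractFirstMatrix φ).toLinearMap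

lemma contractLastMatrix_apply_zero_zero (φ : Module.Dual k V) (x : TensorAlgebra k V) :
    contractLastMatrix φ x 0 0 = x := by
  suffices h : contractLastMatrix φ x 0 0 = x ∧ contractLastMatrix φ x 1 0 = 0 from h.1
  induction x using TensorAlgebra.induction with
  | algebraMap c => simp [Matrix.algebraMap_matrix_apply]
  | ι v => simp [contractLastMatrix]
  | mul a b ha hb => simp [Matrix.mul_apply, Fin.sum_univ_two, ha, hb]
  | add a b ha hb => simp [ha, hb]

lemma contractFirstMatrix_apply_one_one (φ : Module.Dual k V) (x : TensorAlgebra k V) :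
    contractFirstMatrix φ x 1 1 = x := by
  suffices h : contractFirstMatrix φ x 1 1 = x ∧ contractFirstMatrix φ x 1 0 = 0 from h.1
  induction x using TensorAlgebra.induction with
  | algebraMap c => simp [Matrix.algebraMap_matrix_apply]
  | ι v => simp [contractFirstMatrix]
  | mul a b ha hb => simp [Matrix.mul_apply, Fin.sum_univ_two, ha, hb]
  | add a b ha hb => simp [ha, hb]

@[simp]
lemma contractLast_mul_ι (φ : Module.Dual k V) (x : TensorAlgebra k V) (v : V) :
    contractLast φ (x * ι k v) = φ v • x := by
  have h : contractLastMatrix φ (ι k v) = !![ι k v, algebraMap k _ (φ v); 0, 0] := by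
    simp [contractLastMatrix]
  simp [contractLast, Matrix.mul_apply, Fin.sum_univ_two, contractLastMatrix_apply_zero_zero, h,
    Algebra.smul_def, Algebra.commutes]

@[simp]
lemma contractFirst_ι_mul (φ : Module.Dual k V) (v : V) (x : TensorAlgebra k V) :
    contractFirst φ (ι k v * x) = φ v • x := by
  have h : contractFirstMatrix φ (ι k v) = !![0, algebraMap k _ (φ v); 0, ι k v] := by
    simp [contractFirstMatrix]
  rw [contractFirst, LinearMap.comp_apply, AlgHom.toLinearMap_apply, map_mul, h]
  simp [-Matrix.cons_mul, Matrix.mul_apply, Fin.sum_univ_two, contractFirstMatrix_apply_one_one,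
    Algebra.smul_def]

@[elab_as_elim]
lemma mul_degreeOne_induction {P : Submodule k (TensorAlgebra k V)}
    {C : TensorAlgebra k V → Prop} {z : TensorAlgebra k V}
    (hz : z ∈ P * degreeOne k V)
    (mul_ι : ∀ x ∈ P, ∀ v : V, C (x * ι k v)) (add : ∀ x y, C x → C y → C (x + y)) : C z := by
  refine Submodule.mul_induction_on hz ?_ add
  rintro x hx _ ⟨v, rfl⟩
  exact mul_ι x hx v

@[elab_as_elim]
lemma degreeOne_mul_induction {P : Submodule k (TensorAlgebra k V)}
    {C : TensorAlgebra k V → Prop} {z : TensorAlgebra k V}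
    (hz : z ∈ degreeOne k V * P)
    (ι_mul : ∀ x ∈ P, ∀ v : V, C (ι k v * x)) (add : ∀ x y, C x → C y → C (x + y)) : C z := by
  refine Submodule.mul_induction_on hz ?_ add
  rintro _ ⟨v, rfl⟩ x hx
  exact ι_mul x hx v

lemma contractLast_mem (φ : Module.Dual k V) {P : Submodule k (TensorAlgebra k V)}
    {z : TensorAlgebra k V} (hz : z ∈ P * degreeOne k V) : contractLast φ z ∈ P := by
  refine mul_degreeOne_induction hz (fun x hx v => ?_) (fun x y hx hy => ?_)
  · simpa using P.smul_mem _ hx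
  · simpa using P.add_mem hx hy

lemma contractLast_mul (φ : Module.Dual k V) (x : TensorAlgebra k V)
    {P : Submodule k (TensorAlgebra k V)} {y : TensorAlgebra k V} (hy : y ∈ P * degreeOne k V) :
    contractLast φ (x * y) = x * contractLast φ y := by
  refine mul_degreeOne_induction hy (fun y _ v => ?_) (fun y z hy hz => ?_)
  · simp [← mul_assoc]
  · simp [mul_add, hy, hz]

lemma contractFirst_mul (φ : Module.Dual k V) {P : Submodule k (TensorAlgebra k V)}
    {x : TensorAlgebra k V} (hx : x ∈ degreeOne k V * P) (y : TensorAlgebra k V) :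
    contractFirst φ (x * y) = contractFirst φ x * y := by
  refine degreeOne_mul_induction hx (fun x _ v => ?_) (fun x z hx hz => ?_)
  · simp [mul_assoc]
  · simp [add_mul, hx, hz]

lemma contractLast_add_left (φ ψ : Module.Dual k V) {P : Submodule k (TensorAlgebra k V)}
    {z : TensorAlgebra k V} (hz : z ∈ P * degreeOne k V) :
    contractLast (φ + ψ) z = contractLast φ z + contractLast ψ z := by
  refine mul_degreeOne_induction hz (fun x _ v => ?_) (fun x y hx hy => ?_)
  · simp [add_smul]
  · simp only [map_add, hx, hy]; abel

lemma contractFirst_add_left (φ ψ : Module.Dual k V) {P : Submodule k (TensorAlgebra k V)}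
    {z : TensorAlgebra k V} (hz : z ∈ degreeOne k V * P) :
    contractFirst (φ + ψ) z = contractFirst φ z + contractFirst ψ z := by
  refine degreeOne_mul_induction hz (fun x _ v => ?_) (fun x y hx hy => ?_)
  · simp [add_smul]
  · simp only [map_add, hx, hy]; abel

section FiniteDimensional

variable [FiniteDimensional k V]

lemma exists_contractLast_ne_zero {P : Submodule k (TensorAlgebra k V)}
    {z : TensorAlgebra k V} (hz : z ∈ P * degreeOne k V) (hz0 : z ≠ 0) :
    ∃ φ : Module.Dual k V, contractLast φ z ≠ 0 := by
  by_contra! h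
  let b := Module.finBasis k V
  have key : ∑ i, contractLast (b.coord i) z * ι k (b i) = z := by
    refine mul_degreeOne_induction hz (fun x _ v => ?_) (fun x y hx hy => ?_)
    · conv_rhs => rw [← b.sum_repr v]
      simp [-Module.Basis.sum_repr, Finset.mul_sum]
    · simp [add_mul, Finset.sum_add_distrib, hx, hy]
  exact hz0 (by simpa [h] using key.symm)

lemma exists_contractFirst_ne_zero {P : Submodule k (TensorAlgebra k V)}
    {z : TensorAlgebra k V} (hz : z ∈ degreeOne k V * P) (hz0 : z ≠ 0) :
    ∃ φ : Module.Dual k V, contractFirst φ z ≠ 0 := by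
  by_contra! h
  let b := Module.finBasis k V
  have key : ∑ i, ι k (b i) * contractFirst (b.coord i) z = z := by
    refine degreeOne_mul_induction hz (fun x _ v => ?_) (fun x y hx hy => ?_)
    · conv_rhs => rw [← b.sum_repr v]
      simp [-Module.Basis.sum_repr, Finset.sum_mul]
    · simp [mul_add, Finset.sum_add_distrib, hx, hy]
  exact hz0 (by simpa [h] using key.symm)

/-- Two nonzero tensors of positive degree admit a common linear form whose contraction with the
first factor of one and with the last factor of the other are both nonzero. -/
lemma exists_contractFirst_ne_zero_and_contractLast_ne_zero
    {P Q : Submodule k (TensorAlgebra k V)} {x y : TensorAlgebra k V}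
    (hx : x ∈ degreeOne k V * P) (hx0 : x ≠ 0) (hy : y ∈ Q * degreeOne k V) (hy0 : y ≠ 0) :
    ∃ φ : Module.Dual k V, contractFirst φ x ≠ 0 ∧ contractLast φ y ≠ 0 := by
  obtain ⟨φ, hφ⟩ := exists_contractFirst_ne_zero hx hx0
  obtain ⟨ψ, hψ⟩ := exists_contractLast_ne_zero hy hy0
  by_cases h₁ : contractLast φ y = 0
  · by_cases h₂ : contractFirst ψ x = 0
    · exact ⟨φ + ψ, by simpa [contractFirst_add_left φ ψ hx, h₂] using hφ,
        by simpa [contractLast_add_left φ ψ hy, h₁] using hψ⟩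
    · exact ⟨ψ, h₂, hψ⟩
  · exact ⟨φ, hφ, h₁⟩

/-- Left cancellation in the tensor algebra: if `x * u = w * y` with `u ≠ 0` homogeneous of degree
at most that of `y`, then `x` is a right multiple of `w`. -/
lemma exists_eq_mul_of_mul_eq_mul {m j : ℕ} {x u w y : TensorAlgebra k V}
    (hu : u ∈ degreeOne k V ^ m) (hu0 : u ≠ 0) (hy : y ∈ degreeOne k V ^ (j + m))
    (h : x * u = w * y) : ∃ g ∈ degreeOne k V ^ j, x = w * g := by
  induction m generalizing u y with
  | zero =>
    obtain ⟨c, rfl⟩ := Submodule.mem_one.1 (by simpa using hu)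
    have hc : c ≠ 0 := by rintro rfl; simp at hu0
    refine ⟨c⁻¹ • y, Submodule.smul_mem _ _ hy, ?_⟩
    rw [mul_smul_comm, ← h, ← Algebra.commutes, ← Algebra.smul_def, inv_smul_smul₀ hc]
  | succ m ih =>
    rw [pow_succ] at hu
    rw [← add_assoc, pow_succ] at hy
    obtain ⟨φ, hφ⟩ := exists_contractLast_ne_zero hu hu0
    refine ih (contractLast_mem φ hu) hφ (contractLast_mem φ hy) ?_
    rw [← contractLast_mul φ x hu, h, contractLast_mul φ w hy]

end FiniteDimensional

lemma contractFirst_contractLast_prod_ofFn (φ : Module.Dual k V) {r : ℕ} (v : Fin (r + 2) → V) :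
    contractFirst φ (contractLast φ (List.ofFn fun i => ι k (v i)).prod) =
      (φ (v 0) * φ (v (Fin.last _))) •
        (List.ofFn fun i : Fin r => ι k (v i.succ.castSucc)).prod := by
  rw [List.ofFn_succ', List.concat_eq_append, List.prod_append, List.prod_singleton,
    contractLast_mul_ι, List.ofFn_succ, List.prod_cons, map_smul, contractFirst_ι_mul, smul_smul,
    mul_comm]
  simp

/-- Contracting an antisymmetric tensor twice with the same linear form gives zero. -/
lemma IsAntisymmetric.contractFirst_contractLast_eq_zero {r : ℕ}
    {a : TensorAlgebra k V} (ha : IsAntisymmetric k (r + 2) a) (φ : Module.Dual k V) :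
    contractFirst φ (contractLast φ a) = 0 := by
  suffices h : Submodule.span k (Set.range (antisymmetriser k (V := V) (r + 2))) ≤
      LinearMap.ker (contractFirst φ ∘ₗ contractLast φ) from h ha
  rw [Submodule.span_le]
  rintro _ ⟨v, rfl⟩
  simp only [SetLike.mem_coe, LinearMap.mem_ker, LinearMap.comp_apply, antisymmetriser, map_sum,
    map_zsmul, contractFirst_contractLast_prod_ofFn]
  set s : Equiv.Perm (Fin (r + 2)) := Equiv.swap 0 (Fin.last _)
  have hs : (0 : Fin (r + 2)) ≠ Fin.last _ := by simp [Fin.ext_iff]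
  refine Finset.sum_involution (fun σ _ => σ * s) (fun σ _ => ?_) (fun σ _ _ h => ?_)
    (fun _ _ => Finset.mem_univ _) (fun σ _ => by simp [s, mul_assoc])
  · have hmid (i : Fin r) : Equiv.swap 0 (Fin.last (r + 1)) i.castSucc.succ = i.castSucc.succ :=
      Equiv.swap_apply_of_ne_of_ne (by simp [Fin.ext_iff]) (by simp [Fin.ext_iff]; omega)
    simp [hmid, Equiv.Perm.sign_swap hs, s, mul_comm (φ (v (σ 0)))]
  · exact hs (Equiv.swap_eq_one_iff.1 (mul_eq_left.1 h))

/-- A nonzero antisymmetric tensor is not a product of two tensors of positive degree. -/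
lemma IsAntisymmetric.eq_zero_of_eq_mul [FiniteDimensional k V] {r : ℕ}
    {a x y : TensorAlgebra k V} (ha : IsAntisymmetric k (r + 2) a)
    {P Q : Submodule k (TensorAlgebra k V)} (hx : x ∈ degreeOne k V * P)
    (hy : y ∈ Q * degreeOne k V) (h : a = x * y) : a = 0 := by
  by_contra ha0
  rw [h, mul_eq_zero, not_or] at ha0
  obtain ⟨φ, hφx, hφy⟩ := exists_contractFirst_ne_zero_and_contractLast_ne_zero hx ha0.1 hy ha0.2
  have h0 := ha.contractFirst_contractLast_eq_zero φ
  rw [h, contractLast_mul φ x hy, contractFirst_mul φ hx] at h0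
  exact mul_ne_zero hφx hφy h0

lemma IsAntisymmetric.span_mul_inf_mul_span_eq_bot [FiniteDimensional k V]
    {N m : ℕ} {f : TensorAlgebra k V} (hf0 : f ≠ 0) (hfN : f ∈ degreeOne k V ^ N)
    (hfa : IsAntisymmetric k N f) (hm : 1 ≤ m) (hmN : m < N) :
    Submodule.span k {f} * degreeOne k V ^ m ⊓ degreeOne k V ^ m * Submodule.span k {f} = ⊥ := by
  rw [eq_bot_iff]
  rintro z ⟨hzl, hzr⟩
  obtain ⟨u, hu, rfl⟩ := Submodule.mem_span_singleton_mul.1 hzl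
  obtain ⟨w, hw, h⟩ := Submodule.mem_mul_span_singleton.1 hzr
  by_contra hz0
  have hu0 : u ≠ 0 := by rintro rfl; simp at hz0
  obtain ⟨i, rfl⟩ := Nat.exists_eq_add_of_le' hm
  obtain ⟨j, rfl⟩ : ∃ j, N = j + 1 + (i + 1) := ⟨N - i - 2, by omega⟩
  obtain ⟨g, hg, hfg⟩ := exists_eq_mul_of_mul_eq_mul hu hu0 hfN h.symm
  rw [pow_succ'] at hw
  rw [pow_succ] at hg
  have hfa' : IsAntisymmetric k (j + i + 2) f := by convert hfa using 1; omega
  exact hf0 (hfa'.eq_zero_of_eq_mul hw hg hfg)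

/-- Trivial intersection is preserved by multiplication on the right by powers of the degree-one
part. -/
lemma mul_degreeOne_pow_inf_eq_bot [FiniteDimensional k V] {P Q : Submodule k (TensorAlgebra k V)}
    (h : P ⊓ Q = ⊥) (q : ℕ) : P * degreeOne k V ^ q ⊓ Q * degreeOne k V ^ q = ⊥ := by
  induction q with
  | zero => simpa using h
  | succ q ih =>
    rw [eq_bot_iff]
    rintro z ⟨hzP, hzQ⟩
    rw [SetLike.mem_coe, pow_succ, ← mul_assoc] at hzP hzQ
    by_contra hz0
    obtain ⟨φ, hφ⟩ := exists_contractLast_ne_zero hzP hz0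
    exact hφ ((Submodule.mem_bot k).1 (ih ▸ ⟨contractLast_mem φ hzP, contractLast_mem φ hzQ⟩))

end Contraction

/-- If `char k = 0`, `2 ≤ N ≤ n = dim V`, and `f` is a nonzero antisymmetric element of
degree `N`, then for `R = span {f}` we have `(R·𝒱^m) ⊓ (𝒱^m·R) = ⊥` for `1 ≤ m ≤ N-1`,
and consequently `W_m = ⨅_{p+N+q=m} 𝒱^p·R·𝒱^q = ⊥` for all `m ≥ N+1`. -/
theorem antisymmetric_relation_overlaps_trivial
    {k : Type*} [Field k] [CharZero k] {V : Type*} [AddCommGroup V] [Module k V]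
    [FiniteDimensional k V]
    (N : ℕ) (hN2 : 2 ≤ N) (hNn : N ≤ Module.finrank k V)
    (f : TensorAlgebra k V) (hf0 : f ≠ 0) (hfN : f ∈ (degreeOne k V) ^ N)
    (hfa : IsAntisymmetric k N f)
    (R : Submodule k (TensorAlgebra k V)) (hR : R = Submodule.span k {f}) :
    (∀ m : ℕ, 1 ≤ m → m ≤ N - 1 →
        R * (degreeOne k V) ^ m ⊓ (degreeOne k V) ^ m * R = ⊥) ∧
    (∀ m : ℕ, N + 1 ≤ m →
        (⨅ (p : ℕ × ℕ) (_ : p.1 + N + p.2 = m),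
          (degreeOne k V) ^ p.1 * R * (degreeOne k V) ^ p.2) = ⊥) := by
  subst hR
  refine ⟨fun m hm hmN => hfa.span_mul_inf_mul_span_eq_bot hf0 hfN hm (by omega), fun m hm => ?_⟩
  obtain ⟨q, rfl⟩ := Nat.exists_eq_add_of_le hm
  have h := mul_degreeOne_pow_inf_eq_bot
    (hfa.span_mul_inf_mul_span_eq_bot hf0 hfN le_rfl (by omega)) q
  rw [eq_bot_iff, ← h]
  refine le_inf ((iInf₂_le (0, q + 1) (by dsimp only; omega)).trans ?_)
    ((iInf₂_le (1, q) (by dsimp only; omega)).trans ?_)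
  · simp [pow_succ', mul_assoc]
  · simp
end

section
/- Let k be a field of characteristic zero and V a finite-dimensional k-vector space of dimension n. Let 1 ≤ s < r ≤ n. If a ∈ 𝒱^r is a nonzero antisymmetric element, then a is not divisible on the left by an antisymmetric element of degree s: there exist no antisymmetric b ∈ 𝒱^s and no c ∈ 𝒱^{r−s} with a = b·c; likewise a is not divisible on the right: there exist no c′ ∈ 𝒱^{r−s} and antisymmetric b′ ∈ 𝒱^s with a = c′·b′. -/
open Module

/-- The algebra isomorphism between the tensor algebra and the algebra of the free monoid on the
index set of a basis. -/
noncomputable def tensorAlgebraEquivWords {k V κ : Type*} [CommRing k] [AddCommGroup V]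
    [Module k V] (e : Basis κ k V) :
    TensorAlgebra k V ≃ₐ[k] MonoidAlgebra k (FreeMonoid κ) :=
  (TensorAlgebra.equivFreeAlgebra e).trans FreeAlgebra.equivMonoidAlgebraFreeMonoid

section WordCoefficients

variable {k V κ : Type*} [CommRing k] [AddCommGroup V] [Module k V] (e : Basis κ k V)

/-- The coefficient of a word in the basis vectors in an element of the tensor algebra. -/
noncomputable def wordCoeff (w : FreeMonoid κ) : TensorAlgebra k V →ₗ[k] k where
  toFun x := (tensorAlgebraEquivWords e x).coeff w
  map_add' x y := by simp
  map_smul' c x := by simp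

lemma eq_zero_of_wordCoeff {x : TensorAlgebra k V} (h : ∀ w, wordCoeff e w x = 0) : x = 0 :=
  (tensorAlgebraEquivWords e).injective <| by
    rw [map_zero]
    ext w
    exact h w

lemma tensorAlgebraEquivWords_ι_basis (i : κ) :
    tensorAlgebraEquivWords e (TensorAlgebra.ι k (e i)) =
      MonoidAlgebra.single (FreeMonoid.of i) 1 := by
  simp [tensorAlgebraEquivWords, FreeAlgebra.equivMonoidAlgebraFreeMonoid]

lemma wordCoeff_of_ι (v : V) (i : κ) :
    wordCoeff e (FreeMonoid.of i) (TensorAlgebra.ι k v) = e.repr v i := by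
  classical
  suffices wordCoeff e (FreeMonoid.of i) ∘ₗ TensorAlgebra.ι k = e.coord i from
    LinearMap.congr_fun this v
  refine e.ext fun j => ?_
  simp [wordCoeff, tensorAlgebraEquivWords_ι_basis, Finsupp.single_apply,
    FreeMonoid.of_injective.eq_iff]

lemma wordCoeff_ι_of_length_ne (v : V) {w : FreeMonoid κ} (hw : w.length ≠ 1) :
    wordCoeff e w (TensorAlgebra.ι k v) = 0 := by
  classical
  suffices wordCoeff e w ∘ₗ TensorAlgebra.ι k = 0 from LinearMap.congr_fun this v
  refine e.ext fun j => ?_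
  have hj : FreeMonoid.of j ≠ w := by
    rintro rfl
    exact hw (FreeMonoid.length_of j)
  simp [wordCoeff, tensorAlgebraEquivWords_ι_basis, hj]

lemma wordCoeff_mul_of_length {b c : TensorAlgebra k V} {u v : FreeMonoid κ}
    (hb : ∀ w, wordCoeff e w b ≠ 0 → w.length = u.length) :
    wordCoeff e (u * v) (b * c) = wordCoeff e u b * wordCoeff e v c := by
  simp only [wordCoeff, LinearMap.coe_mk, AddHom.coe_mk, map_mul]
  refine MonoidAlgebra.coeff_mul_mul_of_uniqueMul fun u' v' hu' _ h => ?_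
  exact List.append_inj h (hb u' (Finsupp.mem_support_iff.mp hu'))

lemma length_eq_of_wordCoeff_ne_zero {n : ℕ} {x : TensorAlgebra k V}
    (hx : x ∈ degreeOne k V ^ n) {w : FreeMonoid κ} (hw : wordCoeff e w x ≠ 0) :
    w.length = n := by
  classical
  induction hx using Submodule.pow_induction_on_left' generalizing w with
  | algebraMap c =>
    by_contra h
    have h1 : (1 : FreeMonoid κ) ≠ w := fun h1 => h (h1 ▸ FreeMonoid.length_one)
    exact hw (by simp [wordCoeff, h1])
  | add x y i _ _ ihx ihy =>
    rw [map_add] at hw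
    by_cases hx0 : wordCoeff e w x = 0
    · exact ihy fun hy0 => hw (by simp [hx0, hy0])
    · exact ihx hx0
  | mem_mul m hm i x _ ih =>
    obtain ⟨v, rfl⟩ := hm
    simp only [wordCoeff, LinearMap.coe_mk, AddHom.coe_mk, map_mul] at hw
    obtain ⟨u, hu, w', hw', rfl⟩ := Finset.mem_mul.mp
      (MonoidAlgebra.support_coeff_mul_subset _ _ (Finsupp.mem_support_iff.mpr hw))
    rw [FreeMonoid.length_mul, ih (Finsupp.mem_support_iff.mp hw'),
      not_imp_comm.mp (wordCoeff_ι_of_length_ne e v) (Finsupp.mem_support_iff.mp hu), add_comm]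

lemma wordCoeff_prod_ι {n : ℕ} (v : Fin n → V) (w : Fin n → κ) :
    wordCoeff e (FreeMonoid.ofList (List.ofFn w))
      (List.ofFn fun i => TensorAlgebra.ι k (v i)).prod = ∏ i, e.repr (v i) (w i) := by
  induction n with
  | zero => simp [wordCoeff, MonoidAlgebra.one_def]
  | succ n ih =>
    rw [List.ofFn_succ, List.ofFn_succ, List.prod_cons, FreeMonoid.ofList_cons,
      wordCoeff_mul_of_length e, ih, wordCoeff_of_ι, Fin.prod_univ_succ]
    intro u hu
    rw [FreeMonoid.length_of]
    exact not_imp_comm.mp (wordCoeff_ι_of_length_ne e (v 0)) hu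

lemma wordCoeff_antisymmetriser {n : ℕ} (v : Fin n → V) (w : Fin n → κ) :
    wordCoeff e (FreeMonoid.ofList (List.ofFn w)) (antisymmetriser k n v) =
      (Matrix.of fun i j => e.repr (v i) (w j)).det := by
  rw [antisymmetriser, Matrix.det_apply, map_sum]
  refine Finset.sum_congr rfl fun σ _ => ?_
  rw [map_zsmul, wordCoeff_prod_ι e (fun i => v (σ i)) w, Units.smul_def]
  rfl

lemma IsAntisymmetric.wordCoeff_comp_perm {n : ℕ} {a : TensorAlgebra k V}
    (ha : IsAntisymmetric k n a) (w : Fin n → κ) (σ : Equiv.Perm (Fin n)) :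
    wordCoeff e (FreeMonoid.ofList (List.ofFn (w ∘ σ))) a =
      (Equiv.Perm.sign σ : ℤ) • wordCoeff e (FreeMonoid.ofList (List.ofFn w)) a := by
  induction ha using Submodule.span_induction with
  | mem x hx =>
    obtain ⟨v, rfl⟩ := hx
    rw [wordCoeff_antisymmetriser, wordCoeff_antisymmetriser, zsmul_eq_mul]
    exact Matrix.det_permute' σ (Matrix.of fun i j => e.repr (v i) (w j))
  | zero => simp
  | add x y _ _ hx hy => rw [map_add, map_add, hx, hy, smul_add]
  | smul c x _ hx => rw [map_smul, map_smul, hx, smul_comm]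

lemma IsAntisymmetric.wordCoeff_eq_zero {n : ℕ} {a : TensorAlgebra k V}
    (ha : IsAntisymmetric k n a) {w : Fin n → κ} {i j : Fin n} (hij : i ≠ j) (hw : w i = w j) :
    wordCoeff e (FreeMonoid.ofList (List.ofFn w)) a = 0 := by
  induction ha using Submodule.span_induction with
  | mem x hx =>
    obtain ⟨v, rfl⟩ := hx
    rw [wordCoeff_antisymmetriser]
    exact Matrix.det_zero_of_column_eq hij fun l => by simp [hw]
  | zero => simp
  | add x y _ _ hx hy => rw [map_add, hx, hy, add_zero]
  | smul c x _ hx => rw [map_smul, hx, smul_zero]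

end WordCoefficients

/-- A nonzero antisymmetric element is not a product of homogeneous elements of positive degree:
if the word `I J` occurs in it, then so does the word `I' J'` obtained by exchanging a letter of `I`
with a letter of `J`, hence also `I' J`, which has a repeated letter. -/
theorem IsAntisymmetric.mul_eq_zero {k V : Type*} [Field k] [AddCommGroup V] [Module k V]
    {s t : ℕ} (hs : 0 < s) (ht : 0 < t) {b c : TensorAlgebra k V}
    (hb : b ∈ degreeOne k V ^ s) (hc : c ∈ degreeOne k V ^ t)
    (h : IsAntisymmetric k (s + t) (b * c)) : b * c = 0 := by
  let e := Basis.ofVectorSpace k V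
  have hmul (I : Fin s → _) (J : Fin t → _) :
      wordCoeff e (FreeMonoid.ofList (List.ofFn (Fin.append I J))) (b * c) =
        wordCoeff e (FreeMonoid.ofList (List.ofFn I)) b *
          wordCoeff e (FreeMonoid.ofList (List.ofFn J)) c := by
    rw [List.ofFn_fin_append, FreeMonoid.ofList_append, wordCoeff_mul_of_length]
    intro w hw
    rw [length_eq_of_wordCoeff_ne_zero e hb hw]
    exact List.length_ofFn.symm
  refine eq_zero_of_wordCoeff e fun x => ?_
  by_contra hx
  have hlen : x.toList.length = s + t :=
    length_eq_of_wordCoeff_ne_zero e (pow_add (degreeOne k V) s t ▸ Submodule.mul_mem_mul hb hc) hx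
  obtain ⟨w, rfl⟩ : ∃ w : Fin (s + t) → _, x = FreeMonoid.ofList (List.ofFn w) :=
    ⟨fun i => x.toList.get (i.cast hlen.symm), by
      rw [← List.ofFn_congr hlen, List.ofFn_get, FreeMonoid.ofList_toList]⟩
  let p : Fin (s + t) := Fin.castAdd t ⟨0, hs⟩
  let q : Fin (s + t) := Fin.natAdd s ⟨0, ht⟩
  have hpq : p ≠ q := Fin.ne_of_val_ne (by simp [p, q, hs.ne])
  let w' := w ∘ Equiv.swap p q
  have hx' : wordCoeff e (FreeMonoid.ofList (List.ofFn w')) (b * c) ≠ 0 := by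
    rw [h.wordCoeff_comp_perm, Equiv.Perm.sign_swap hpq]
    simpa using hx
  rw [← Fin.append_castAdd_natAdd (f := w), hmul] at hx
  rw [← Fin.append_castAdd_natAdd (f := w'), hmul] at hx'
  refine mul_ne_zero (left_ne_zero_of_mul hx') (right_ne_zero_of_mul hx) ?_
  rw [← hmul]
  refine h.wordCoeff_eq_zero e hpq ?_
  rw [Fin.append_left, Fin.append_right]
  exact congrArg w (Equiv.swap_apply_left p q)

/-- Over a field of characteristic zero, for `1 ≤ s < r ≤ n = dim V`, a nonzero
antisymmetric element of degree `r` is never divisible on the left, nor on the right,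
by an antisymmetric element of degree `s`. -/
theorem antisymmetric_not_divisible_by_antisymmetric
    {k : Type*} [Field k] [CharZero k] {V : Type*} [AddCommGroup V] [Module k V]
    [FiniteDimensional k V]
    (s r : ℕ) (hs : 1 ≤ s) (hsr : s < r) (hrn : r ≤ Module.finrank k V)
    (a : TensorAlgebra k V) (haN : a ∈ (degreeOne k V) ^ r)
    (haa : IsAntisymmetric k r a) (ha0 : a ≠ 0) :
    (¬ ∃ b c : TensorAlgebra k V, b ∈ (degreeOne k V) ^ s ∧ IsAntisymmetric k s b ∧
        c ∈ (degreeOne k V) ^ (r - s) ∧ a = b * c) ∧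
    (¬ ∃ c' b' : TensorAlgebra k V, c' ∈ (degreeOne k V) ^ (r - s) ∧
        b' ∈ (degreeOne k V) ^ s ∧ IsAntisymmetric k s b' ∧ a = c' * b') := by
  obtain ⟨t, rfl⟩ := Nat.exists_eq_add_of_lt hsr
  rw [add_assoc, Nat.add_sub_cancel_left] at *
  refine ⟨?_, ?_⟩
  · rintro ⟨b, c, hb, -, hc, rfl⟩
    exact ha0 (haa.mul_eq_zero hs t.succ_pos hb hc)
  · rintro ⟨c, b, hc, hb, -, rfl⟩
    exact ha0 (IsAntisymmetric.mul_eq_zero t.succ_pos hs hc hb (add_comm s (t + 1) ▸ haa))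
end

section
/- Let k be a field and W a k-vector space with submodules U and U′ such that W is the internal direct sum of U and U′ (IsCompl U U′). In T(W), let 𝒰 := ι(U), 𝒰′ := ι(U′) (images as submodules) and 𝒱 := 𝒰 ⊔ 𝒰′. Let N ≥ 2, let R be a submodule of 𝒰^N and R′ a submodule of 𝒰′^N, and set ℛ := R ⊔ R′. Fix m with 2 ≤ m ≤ N−1. If (R · 𝒰^m) ⊓ (𝒰^m · R) ≤ 𝒰^{m−1} · R · 𝒰 and (R′ · 𝒰′^m) ⊓ (𝒰′^m · R′) ≤ 𝒰′^{m−1} · R′ · 𝒰′, then (ℛ · 𝒱^m) ⊓ (𝒱^m · ℛ) ≤ 𝒱^{m−1} · ℛ · 𝒱. (Core of: a free product of two N-Koszul distributive N-homogeneous algebras satisfies the extra overlap condition.) -/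
open scoped Pointwise

namespace TensorAlgebra

variable {k W : Type*} [Field k] [AddCommGroup W] [Module k W]

/-- The algebra map `T(W) → T(W)⟨x_c⟩`, `w ↦ ∑ c, e c w · x_c`, recording in the words of a
free monoid which of the linear maps `e c` is applied to each tensor factor. -/
noncomputable def wordMap (e : Bool → W →ₗ[k] W) :
    TensorAlgebra k W →ₐ[k] MonoidAlgebra (TensorAlgebra k W) (FreeMonoid Bool) :=
  lift k (∑ c, MonoidAlgebra.lsingle (R := k) (FreeMonoid.of c) ∘ₗ ι k ∘ₗ e c)

/-- Specialisation of the formal letters `x_c` to scalars `s c`. -/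
noncomputable def evalWords (s : Bool → k) :
    MonoidAlgebra (TensorAlgebra k W) (FreeMonoid Bool) →ₐ[k] TensorAlgebra k W :=
  MonoidAlgebra.liftNCAlgHom (AlgHom.id k _)
    ((algebraMap k (TensorAlgebra k W) : k →* TensorAlgebra k W).comp (FreeMonoid.lift s))
    fun x y => Algebra.commute_algebraMap_right (FreeMonoid.lift s y) x

lemma wordMap_ι (e : Bool → W →ₗ[k] W) (w : W) :
    wordMap e (ι k w) = ∑ c, MonoidAlgebra.single (FreeMonoid.of c) (ι k (e c w)) := by
  simp [wordMap]

lemma evalWords_single (s : Bool → k) (v : FreeMonoid Bool) (x : TensorAlgebra k W) :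
    evalWords s (MonoidAlgebra.single v x) = FreeMonoid.lift s v • x := by
  rw [Algebra.smul_def, Algebra.commutes]
  exact MonoidAlgebra.liftNC_single _ _ _ _

lemma evalWords_wordMap_ι (s : Bool → k) (e : Bool → W →ₗ[k] W) (w : W) :
    evalWords s (wordMap e (ι k w)) = ι k (∑ c, s c • e c w) := by
  simp [wordMap_ι, evalWords_single]

lemma evalWords_one_wordMap {e : Bool → W →ₗ[k] W} (he : ∀ w, ∑ c, e c w = w)
    (x : TensorAlgebra k W) : evalWords (fun _ => (1 : k)) (wordMap e x) = x := by
  have h : (evalWords (fun _ => (1 : k))).comp (wordMap e) = AlgHom.id k _ := by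
    ext w
    simp only [LinearMap.coe_comp, Function.comp_apply, AlgHom.toLinearMap_apply, AlgHom.comp_apply,
      evalWords_wordMap_ι, one_smul, he, AlgHom.id_apply]
  exact DFunLike.congr_fun h x

/-- The tensors whose image under `wordMap e` only involves words in `S`. -/
noncomputable def wordSupported (e : Bool → W →ₗ[k] W) (S : Set (FreeMonoid Bool)) :
    Submodule k (TensorAlgebra k W) where
  carrier := {x | ∀ v, (wordMap e x).coeff v ≠ 0 → v ∈ S}
  zero_mem' := by simp
  add_mem' {x y} hx hy v hv := by
    by_contra hS
    have hx' := not_imp_comm.1 (hx v) hS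
    have hy' := not_imp_comm.1 (hy v) hS
    simp [hx', hy'] at hv
  smul_mem' a x hx v hv := by
    refine hx v fun h => hv ?_
    simp [h]

lemma wordSupported_mono (e : Bool → W →ₗ[k] W) {S S' : Set (FreeMonoid Bool)} (h : S ⊆ S') :
    wordSupported e S ≤ wordSupported e S' :=
  fun _ hx v hv => h (hx v hv)

lemma wordSupported_mul_le (e : Bool → W →ₗ[k] W) (S S' : Set (FreeMonoid Bool)) :
    wordSupported e S * wordSupported e S' ≤ wordSupported e (S * S') := by
  classical
  refine Submodule.mul_le.2 fun x hx y hy v hv => ?_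
  rw [map_mul] at hv
  obtain ⟨a, ha, b, hb, rfl⟩ := Finset.mem_mul.1
    (MonoidAlgebra.support_coeff_mul_subset _ _ (Finsupp.mem_support_iff.2 hv))
  exact Set.mul_mem_mul (hx a (Finsupp.mem_support_iff.1 ha)) (hy b (Finsupp.mem_support_iff.1 hb))

lemma wordSupported_pow_le (e : Bool → W →ₗ[k] W) (S : Set (FreeMonoid Bool)) (n : ℕ) :
    wordSupported e S ^ n ≤ wordSupported e (S ^ n) := by
  induction n with
  | zero =>
    rw [pow_zero, pow_zero, Submodule.one_le]
    intro v hv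
    by_contra h
    refine hv ?_
    rw [map_one, MonoidAlgebra.one_def, MonoidAlgebra.coeff_single]
    exact Finsupp.single_eq_of_ne h
  | succ n ih =>
    rw [pow_succ, pow_succ]
    exact (mul_le_mul_left ih _).trans (wordSupported_mul_le e _ _)

lemma map_ι_le_wordSupported {e : Bool → W →ₗ[k] W} {P : Submodule k W} {c : Bool}
    (hP : ∀ w ∈ P, e (!c) w = 0) : P.map (ι k) ≤ wordSupported e {FreeMonoid.of c} := by
  rintro _ ⟨w, hw, rfl⟩ v hv
  by_contra h
  refine hv ?_
  have h' : FreeMonoid.of c ≠ v := fun h' => h h'.symm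
  cases c <;> simp_all [wordMap_ι]

lemma _root_.FreeMonoid.length_of_mem_pow {S : Set (FreeMonoid Bool)} (hS : ∀ v ∈ S, v.length = 1) (n : ℕ)
    {v : FreeMonoid Bool} (hv : v ∈ S ^ n) : v.length = n := by
  induction n generalizing v with
  | zero => simp_all
  | succ n ih =>
    rw [pow_succ] at hv
    obtain ⟨a, ha, b, hb, rfl⟩ := hv
    simp [ih ha, hS b hb]

lemma _root_.List.eq_replicate_of_overlap {α : Type*} {N m : ℕ} (hmN : m < N) {c d : α} {u v : List α}
    (hu : u.length = m) (hv : v.length = m)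
    (h : List.replicate N c ++ u = v ++ List.replicate N d) :
    List.replicate N c ++ u = List.replicate (N + m) c := by
  have hget (i : ℕ) : (List.replicate N c ++ u)[i]? = (v ++ List.replicate N d)[i]? := by rw [h]
  have hcd : c = d := by
    have := hget m
    simpa [List.getElem?_append, hv, hmN, Nat.sub_pos_of_lt, show 0 < N by omega] using this
  subst hcd
  refine List.ext_getElem? fun i => ?_
  by_cases hi : i < N
  · rw [List.getElem?_append_left (by simpa)]
    simp [hi, List.getElem?_replicate]
    omega
  · rw [h, List.getElem?_append_right (by omega), hv]
    simp only [List.getElem?_replicate]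
    split_ifs <;> first | rfl | omega

lemma eq_add_of_mem_wordSupported {e : Bool → W →ₗ[k] W} (he : ∀ w, ∑ c, e c w = w)
    {n : ℕ} (hn : n ≠ 0) {x : TensorAlgebra k W}
    (hx : x ∈ wordSupported e {v | ∃ c, v = FreeMonoid.of c ^ n}) :
    x = evalWords (Pi.single true 1) (wordMap e x) +
      evalWords (Pi.single false 1) (wordMap e x) := by
  classical
  have hne : FreeMonoid.of true ^ n ≠ FreeMonoid.of false ^ n := fun h => by
    have := congrArg (FreeMonoid.lift (fun c : Bool => if c then (1 : ℕ) else 0)) h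
    simp [hn] at this
  have hdec : wordMap e x =
      MonoidAlgebra.single (FreeMonoid.of true ^ n) ((wordMap e x).coeff (FreeMonoid.of true ^ n)) +
      MonoidAlgebra.single (FreeMonoid.of false ^ n)
        ((wordMap e x).coeff (FreeMonoid.of false ^ n)) := by
    ext v
    by_cases hv : (wordMap e x).coeff v = 0
    · rw [MonoidAlgebra.coeff_add, Finsupp.add_apply, MonoidAlgebra.coeff_single,
        MonoidAlgebra.coeff_single, Finsupp.single_apply, Finsupp.single_apply]
      split_ifs <;> simp_all
    · obtain ⟨c, rfl⟩ := hx v hv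
      cases c <;> simp [hne, hne.symm]
  conv_lhs => rw [← evalWords_one_wordMap he x]
  rw [hdec]
  simp [evalWords_single, hn]

lemma sup_mul_sup_pow_inf_le_wordSupported {e : Bool → W →ₗ[k] W} {U U' : Submodule k W}
    (hU : ∀ w ∈ U, e false w = 0) (hU' : ∀ w ∈ U', e true w = 0) {N m : ℕ} (hmN : m < N)
    {R R' : Submodule k (TensorAlgebra k W)}
    (hR : R ≤ U.map (ι k) ^ N) (hR' : R' ≤ U'.map (ι k) ^ N) :
    (R ⊔ R') * (U.map (ι k) ⊔ U'.map (ι k)) ^ m ⊓ (U.map (ι k) ⊔ U'.map (ι k)) ^ m * (R ⊔ R') ≤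
      wordSupported e {v | ∃ c, v = FreeMonoid.of c ^ (N + m)} := by
  have hUs : U.map (ι k) ≤ wordSupported e {FreeMonoid.of true} := map_ι_le_wordSupported hU
  have hUs' : U'.map (ι k) ≤ wordSupported e {FreeMonoid.of false} := map_ι_le_wordSupported hU'
  have hpow (c : Bool) : wordSupported e {FreeMonoid.of c} ^ N ≤
      wordSupported e {v | ∃ c, v = FreeMonoid.of c ^ N} :=
    (wordSupported_pow_le e _ N).trans (wordSupported_mono e (by
      rw [Set.singleton_pow]
      exact Set.singleton_subset_iff.2 ⟨c, rfl⟩))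
  have hRs : R ⊔ R' ≤ wordSupported e {v | ∃ c, v = FreeMonoid.of c ^ N} :=
    sup_le (hR.trans ((pow_le_pow_left' hUs N).trans (hpow true)))
      (hR'.trans ((pow_le_pow_left' hUs' N).trans (hpow false)))
  have hVs : (U.map (ι k) ⊔ U'.map (ι k)) ^ m ≤ wordSupported e {v | v.length = m} := by
    have h1 : U.map (ι k) ⊔ U'.map (ι k) ≤ wordSupported e {v | v.length = 1} :=
      sup_le (hUs.trans (wordSupported_mono e (by simp)))
        (hUs'.trans (wordSupported_mono e (by simp)))
    exact ((pow_le_pow_left' h1 m).trans (wordSupported_pow_le e _ m)).trans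
      (wordSupported_mono e fun v hv => FreeMonoid.length_of_mem_pow (fun _ h => h) m hv)
  rintro x ⟨hx, hx'⟩ v hv
  obtain ⟨_, ⟨c, rfl⟩, u, hu, h⟩ :=
    wordSupported_mul_le e _ _ (mul_le_mul' hRs hVs hx) v hv
  obtain ⟨u', hu', _, ⟨d, rfl⟩, h'⟩ :=
    wordSupported_mul_le e _ _ (mul_le_mul' hVs hRs hx') v hv
  have htoList (c : Bool) (n : ℕ) : (FreeMonoid.of c ^ n).toList = List.replicate n c := by
    induction n with
    | zero => rfl
    | succ n ih => rw [pow_succ', FreeMonoid.toList_of_mul, ih, List.replicate_succ]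
  refine ⟨c, FreeMonoid.toList.injective ?_⟩
  have h1 := congrArg FreeMonoid.toList h
  have h2 := congrArg FreeMonoid.toList h'
  simp only [FreeMonoid.toList_mul, htoList] at h1 h2
  rw [htoList, ← h1]
  exact List.eq_replicate_of_overlap hmN hu hu' (h1.trans h2.symm)

end TensorAlgebra

namespace Submodule

variable {k A : Type*} [Field k] [Ring A] [Algebra k A]

lemma map_eq_self_of_le_pow (p : A →ₐ[k] A) {P R : Submodule k A} (hP : ∀ x ∈ P, p x = x)
    {n : ℕ} (hR : R ≤ P ^ n) : R.map p.toLinearMap = R := by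
  have hfix (x : A) (hx : x ∈ R) : p x = x :=
    Submodule.pow_induction_on_left (C := fun x => p x = x) P (fun r => p.commutes r)
      (fun x y hx hy => by rw [map_add, hx, hy])
      (fun y hy x hx => by rw [map_mul, hP y hy, hx]) (hR hx)
  refine le_antisymm ?_ fun x hx => ⟨x, hx, hfix x hx⟩
  rintro _ ⟨x, hx, rfl⟩
  rwa [AlgHom.toLinearMap_apply, hfix x hx]

lemma map_sup_mul_inf_le (p : A →ₐ[k] A) {P P' R R' : Submodule k A}
    (hP : ∀ x ∈ P, p x = x) (hP' : ∀ x ∈ P', p x = 0) {N : ℕ} (hN : N ≠ 0)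
    (hR : R ≤ P ^ N) (hR' : R' ≤ P' ^ N) (m : ℕ) :
    ((R ⊔ R') * (P ⊔ P') ^ m ⊓ (P ⊔ P') ^ m * (R ⊔ R')).map p.toLinearMap ≤
      R * P ^ m ⊓ P ^ m * R := by
  have hmapP' : P'.map p.toLinearMap = ⊥ := eq_bot_iff.2 (by
    rintro _ ⟨x, hx, rfl⟩
    exact hP' x hx)
  have hmapR' : R'.map p.toLinearMap = ⊥ := eq_bot_iff.2 (by
    refine (Submodule.map_mono hR').trans ?_
    rw [Submodule.map_pow, hmapP', Submodule.bot_pow hN])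
  have hmapP : P.map p.toLinearMap = P := map_eq_self_of_le_pow p hP (pow_one P).ge
  refine (Submodule.map_inf_le _).trans ?_
  simp only [Submodule.map_mul, Submodule.map_pow, Submodule.map_sup, hmapP, hmapP', hmapR',
    map_eq_self_of_le_pow p hP hR, sup_bot_eq, le_refl]

end Submodule


/-- **Free products and the extra overlap condition.** Let `W = U ⊕ U'`, let
`𝒰, 𝒰'` be the images of `U, U'` in the tensor algebra `T(W)`, `𝒱 = 𝒰 ⊔ 𝒰'`,
let `R ≤ 𝒰^N`, `R' ≤ 𝒰'^N` and `ℛ = R ⊔ R'`. If, for a fixed `m` with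
`2 ≤ m ≤ N-1`, both `(R·𝒰^m) ⊓ (𝒰^m·R) ≤ 𝒰^{m-1}·R·𝒰` and
`(R'·𝒰'^m) ⊓ (𝒰'^m·R') ≤ 𝒰'^{m-1}·R'·𝒰'`, then
`(ℛ·𝒱^m) ⊓ (𝒱^m·ℛ) ≤ 𝒱^{m-1}·ℛ·𝒱`. -/
theorem free_product_overlap_condition
    {k : Type*} [Field k] {W : Type*} [AddCommGroup W] [Module k W]
    (U U' : Submodule k W) (hUU' : IsCompl U U')
    (N m : ℕ) (hN : 2 ≤ N) (hm2 : 2 ≤ m) (hmN : m ≤ N - 1)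
    (𝒰 𝒰' 𝒱 : Submodule k (TensorAlgebra k W))
    (h𝒰 : 𝒰 = U.map (TensorAlgebra.ι k : W →ₗ[k] TensorAlgebra k W))
    (h𝒰' : 𝒰' = U'.map (TensorAlgebra.ι k : W →ₗ[k] TensorAlgebra k W))
    (h𝒱 : 𝒱 = 𝒰 ⊔ 𝒰')
    (R R' ℛ : Submodule k (TensorAlgebra k W))
    (hR : R ≤ 𝒰 ^ N) (hR' : R' ≤ 𝒰' ^ N) (hℛ : ℛ = R ⊔ R')
    (hKoszul : R * 𝒰 ^ m ⊓ 𝒰 ^ m * R ≤ 𝒰 ^ (m - 1) * R * 𝒰)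
    (hKoszul' : R' * 𝒰' ^ m ⊓ 𝒰' ^ m * R' ≤ 𝒰' ^ (m - 1) * R' * 𝒰') :
    ℛ * 𝒱 ^ m ⊓ 𝒱 ^ m * ℛ ≤ 𝒱 ^ (m - 1) * ℛ * 𝒱 := by
  subst h𝒰 h𝒰' h𝒱 hℛ
  let e : Bool → W →ₗ[k] W :=
    fun c => if c then U.projection U' hUU' else U'.projection U hUU'.symm
  have he (w : W) : ∑ c, e c w = w := by
    simpa [e] using Submodule.projection_add_projection_eq_self hUU' w
  have heU : ∀ w ∈ U, e false w = 0 := fun w hw => by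
    simpa [e] using hw
  have heU' : ∀ w ∈ U', e true w = 0 := fun w hw => by
    simpa [e] using hw
  have heU1 : ∀ w ∈ U, e true w = w := fun w hw => by
    simpa [e] using Submodule.projection_apply_of_mem_left hUU' hw
  have heU1' : ∀ w ∈ U', e false w = w := fun w hw => by
    simpa [e] using Submodule.projection_apply_of_mem_left hUU'.symm hw
  intro x hx
  have hsupp := TensorAlgebra.sup_mul_sup_pow_inf_le_wordSupported heU heU' (by omega) hR hR' hx
  rw [TensorAlgebra.eq_add_of_mem_wordSupported he (by omega) hsupp]
  refine add_mem ?_ ?_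
  · refine hKoszul.trans (mul_le_mul' (mul_le_mul'
      (pow_le_pow_left' le_sup_left _) le_sup_left) le_sup_left)
      (Submodule.map_sup_mul_inf_le
        ((TensorAlgebra.evalWords (Pi.single true 1)).comp (TensorAlgebra.wordMap e))
        ?_ ?_ (by omega) hR hR' m (Submodule.mem_map_of_mem hx))
    · rintro _ ⟨w, hw, rfl⟩
      simp [TensorAlgebra.evalWords_wordMap_ι, heU1 w hw]
    · rintro _ ⟨w, hw, rfl⟩
      simp [TensorAlgebra.evalWords_wordMap_ι, heU' w hw]
  · rw [sup_comm (U.map _), sup_comm R] at hx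
    refine hKoszul'.trans (mul_le_mul' (mul_le_mul'
      (pow_le_pow_left' le_sup_right _) le_sup_right) le_sup_right)
      (Submodule.map_sup_mul_inf_le
        ((TensorAlgebra.evalWords (Pi.single false 1)).comp (TensorAlgebra.wordMap e))
        ?_ ?_ (by omega) hR' hR m (Submodule.mem_map_of_mem hx))
    · rintro _ ⟨w, hw, rfl⟩
      simp [TensorAlgebra.evalWords_wordMap_ι, heU1' w hw]
    · rintro _ ⟨w, hw, rfl⟩
      simp [TensorAlgebra.evalWords_wordMap_ι, heU w hw]
end

section
/- Let α be a type and w : List α a list of length N with N ≥ 2. Let m be an integer with 1 ≤ m ≤ N−1, and write N = m·q + r with 0 ≤ r < m (so q = N / m and r = N % m). Then the following are equivalent: (i) there exist lists u, v : List α, both of length m, such that w ++ u = v ++ w; (ii) w equals the concatenation of q copies of (w.take m) followed by (w.take r). (Combinatorial core of the overlap criterion for a single monomial relation.) -/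
/-- If `w ++ u = v ++ w` with `v` nonempty, then `w` is a power of `v` followed by a prefix
of `v`. -/
theorem List.eq_flatten_replicate_append_take_of_append_eq_append {α : Type*} {u v : List α}
    (hv : 0 < v.length) (w : List α) (h : w ++ u = v ++ w) :
    w = (List.replicate (w.length / v.length) v).flatten ++ v.take (w.length % v.length) := by
  rcases lt_or_ge w.length v.length with hlt | hle
  · have hpre : w <+: v :=
      List.prefix_of_prefix_length_le ⟨u, h⟩ (List.prefix_append v w) hlt.le
    rw [Nat.div_eq_of_lt hlt, Nat.mod_eq_of_lt hlt]
    simpa using List.prefix_iff_eq_take.mp hpre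
  · obtain ⟨w', rfl⟩ : v <+: w :=
      List.prefix_of_prefix_length_le (List.prefix_append v w) ⟨u, h⟩ hle
    have h' : w' ++ u = v ++ w' := by simpa using h
    have ih := List.eq_flatten_replicate_append_take_of_append_eq_append hv w' h'
    rw [List.length_append, Nat.add_div_left _ hv, Nat.add_mod_left, List.replicate_succ,
      List.flatten_cons, List.append_assoc, ← ih]
termination_by w.length
decreasing_by
  subst_vars
  rw [List.length_append]
  omega

/-- A power of `v` followed by a prefix `t` of `v = t ++ s` overlaps itself with width
`v.length`. -/
theorem List.flatten_replicate_append_overlap {α : Type*} (n : ℕ) (t s : List α) :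
    ((List.replicate n (t ++ s)).flatten ++ t) ++ (s ++ t) =
      (t ++ s) ++ ((List.replicate n (t ++ s)).flatten ++ t) := by
  induction n with
  | zero => simp
  | succ n ih => simpa [List.replicate_succ] using ih

/-- **Combinatorial core of the overlap criterion for a single monomial relation.**
A word `w` of length `N ≥ 2` has a self-overlap of width `m` (with `1 ≤ m ≤ N-1`),
i.e. `w ++ u = v ++ w` for some words `u, v` of length `m`, if and only if `w` is the
concatenation of `q = N / m` copies of its prefix of length `m` followed by its prefix
of length `r = N % m`. -/
theorem word_self_overlap_iff_periodic
    {α : Type*} (w : List α) (N : ℕ) (hN : 2 ≤ N) (hw : w.length = N)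
    (m : ℕ) (hm1 : 1 ≤ m) (hmN : m ≤ N - 1) :
    (∃ u v : List α, u.length = m ∧ v.length = m ∧ w ++ u = v ++ w) ↔
      w = (List.replicate (N / m) (w.take m)).flatten ++ w.take (N % m) := by
  have hr : N % m ≤ m := (Nat.mod_lt N hm1).le
  constructor
  · rintro ⟨u, v, -, rfl, h⟩
    have hpre : v <+: w :=
      List.prefix_of_prefix_length_le (List.prefix_append v w) ⟨u, h⟩ (by omega)
    have hv : w.take v.length = v := (List.prefix_iff_eq_take.mp hpre).symm
    have htake : w.take (N % v.length) = v.take (N % v.length) := by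
      have := List.take_take (i := N % v.length) (j := v.length) (l := w)
      rw [hv, min_eq_left hr] at this
      exact this.symm
    rw [hv, htake, ← hw]
    exact List.eq_flatten_replicate_append_take_of_append_eq_append hm1 w h
  · intro h
    have hsplit : w.take (N % m) ++ (w.take m).drop (N % m) = w.take m := by
      have := List.take_append_drop (N % m) (w.take m)
      rwa [List.take_take, min_eq_left hr] at this
    refine ⟨(w.take m).drop (N % m) ++ w.take (N % m), w.take m, ?_, ?_, ?_⟩
    · rw [List.length_append, add_comm, ← List.length_append, hsplit, List.length_take]
      omega
    · rw [List.length_take]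
      omega
    · have key := List.flatten_replicate_append_overlap (N / m) (w.take (N % m))
        ((w.take m).drop (N % m))
      rwa [hsplit, ← h] at key
end

section
/- Let k be a field and V a finite-dimensional k-vector space. Let f ∈ 𝒱·𝒱 be a homogeneous quadratic element that is NOT a product of two degree-one elements, i.e. there exist no u, v ∈ V with f = ι(u)·ι(v) (equivalently, the matrix of coefficients of f in any basis has rank > 1). Let A be the quotient of T(V) by the two-sided ideal generated by f, with quotient map π. Then every nonzero element of V is neither a left nor a right zero-divisor in A: for every nonzero v ∈ V and every a ∈ A, a · π(ι(v)) = 0 implies a = 0, and π(ι(v)) · a = 0 implies a = 0. -/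
/-- The relation identifying a fixed element `f` of the tensor algebra with `0`;
`RingQuot` of this relation is the quotient of `T(V)` by the two-sided ideal
generated by `f`. -/
def relOf {k : Type*} [CommSemiring k] {V : Type*} [AddCommMonoid V] [Module k V]
    (f : TensorAlgebra k V) : TensorAlgebra k V → TensorAlgebra k V → Prop :=
  fun a b => a = f ∧ b = 0

namespace TensorAlgebra

section RightContraction

variable {k : Type*} [CommSemiring k] {V : Type*} [AddCommMonoid V] [Module k V]

/-- The right action of `w : V` on `T(V) × T(V)` given by `(a, d) ↦ (a * ι w, φ w • a)`. -/
noncomputable def rightContractionAux (φ : V →ₗ[k] k) :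
    V →ₗ[k] (Module.End k (TensorAlgebra k V × TensorAlgebra k V))ᵐᵒᵖ :=
  (MulOpposite.opLinearEquiv k).toLinearMap ∘ₗ
    LinearMap.mk₂ k (fun w p => (p.1 * ι k w, φ w • p.1))
      (fun w w' p => by simp [mul_add, add_smul])
      (fun c w p => by simp [mul_smul])
      (fun w p q => by simp [add_mul])
      (fun c w p => by simp [smul_comm (φ w) c])

/-- Contraction on the right by a linear form `φ`: the linear endomorphism of `T(V)` that sends
`a * ι w` to `φ w • a`. -/
noncomputable def rightContraction (φ : V →ₗ[k] k) : TensorAlgebra k V →ₗ[k] TensorAlgebra k V :=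
  LinearMap.snd k _ _ ∘ₗ LinearMap.applyₗ (1, 0) ∘ₗ
    (MulOpposite.opLinearEquiv k).symm.toLinearMap ∘ₗ
      (lift k (rightContractionAux φ)).toLinearMap

theorem lift_rightContractionAux_fst (φ : V →ₗ[k] k) (x : TensorAlgebra k V)
    (p : TensorAlgebra k V × TensorAlgebra k V) :
    ((lift k (rightContractionAux φ) x).unop p).1 = p.1 * x := by
  induction x using TensorAlgebra.induction generalizing p with
  | algebraMap r => simp [Algebra.algebraMap_eq_smul_one]
  | ι w => simp [rightContractionAux]
  | mul a b ha hb => simp [ha, hb, mul_assoc]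
  | add a b ha hb => simp [ha, hb, mul_add]

theorem rightContraction_mul_ι (φ : V →ₗ[k] k) (a : TensorAlgebra k V) (w : V) :
    rightContraction φ (a * ι k w) = φ w • a := by
  simpa [rightContraction, rightContractionAux] using
    congrArg (φ w • ·) (lift_rightContractionAux_fst φ a (1, 0))

theorem rightContraction_mem_of_mem_mul_degreeOne (φ : V →ₗ[k] k)
    {P : Submodule k (TensorAlgebra k V)} {x : TensorAlgebra k V} (hx : x ∈ P * degreeOne k V) :
    rightContraction φ x ∈ P := by
  induction hx using Submodule.mul_induction_on' with
  | mem_mul_mem p hp w hw =>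
    obtain ⟨w, rfl⟩ := hw
    rw [rightContraction_mul_ι]
    exact P.smul_mem _ hp
  | add x _ y _ hx hy => rw [map_add]; exact P.add_mem hx hy

end RightContraction

section Reverse

variable {k : Type*} [CommSemiring k] {V : Type*} [AddCommMonoid V] [Module k V]

/-- The anti-automorphism of the tensor algebra that fixes `V`, as a map to the opposite. -/
noncomputable def reverseOp : TensorAlgebra k V →ₐ[k] (TensorAlgebra k V)ᵐᵒᵖ :=
  lift k ((MulOpposite.opLinearEquiv k).toLinearMap ∘ₗ ι k)

@[simp]
theorem unop_reverseOp_ι (v : V) : (reverseOp (ι k v)).unop = ι k v := by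
  simp [reverseOp]

@[simp]
theorem unop_reverseOp_unop_reverseOp (x : TensorAlgebra k V) :
    (reverseOp (reverseOp x).unop).unop = x := by
  induction x using TensorAlgebra.induction with
  | algebraMap r => simp [MulOpposite.algebraMap_apply]
  | ι w => simp
  | mul a b ha hb => simp [ha, hb]
  | add a b ha hb => simp [ha, hb]

theorem unop_reverseOp_mem_degreeOne_mul {f : TensorAlgebra k V}
    (hf : f ∈ degreeOne k V * degreeOne k V) :
    (reverseOp f).unop ∈ degreeOne k V * degreeOne k V := by
  induction hf using Submodule.mul_induction_on' with
  | mem_mul_mem p hp w hw =>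
    obtain ⟨p, rfl⟩ := hp
    obtain ⟨w, rfl⟩ := hw
    rw [map_mul, MulOpposite.unop_mul, unop_reverseOp_ι, unop_reverseOp_ι]
    exact Submodule.mul_mem_mul (LinearMap.mem_range_self _ w) (LinearMap.mem_range_self _ p)
  | add x _ y _ hx hy => simpa using add_mem hx hy

theorem mkRingHom_unop_reverseOp_eq_zero {f x : TensorAlgebra k V}
    (hx : RingQuot.mkRingHom (relOf f) x = 0) :
    RingQuot.mkRingHom (relOf (reverseOp f).unop) (reverseOp x).unop = 0 := by
  have hker : ∀ ⦃a b : TensorAlgebra k V⦄, relOf f a b →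
      ((RingQuot.mkRingHom (relOf (reverseOp f).unop)).op.comp
        (reverseOp : TensorAlgebra k V →ₐ[k] _).toRingHom) a =
      ((RingQuot.mkRingHom (relOf (reverseOp f).unop)).op.comp
        (reverseOp : TensorAlgebra k V →ₐ[k] _).toRingHom) b := by
    rintro a b ⟨rfl, rfl⟩
    apply MulOpposite.unop_injective
    simpa using RingQuot.mkRingHom_rel
      (show relOf (reverseOp a).unop (reverseOp a).unop 0 from ⟨rfl, rfl⟩)
  have h := congrArg (RingQuot.lift ⟨_, hker⟩) hx
  rw [RingQuot.lift_mkRingHom_apply, map_zero] at h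
  simpa using congrArg MulOpposite.unop h

end Reverse

section RelationFiltration

variable {k : Type*} [CommRing k] {V : Type*} [AddCommGroup V] [Module k V]

/-- The sum of the submodules `T(V) * f * V ^ j` over `j < n`. These exhaust the two-sided ideal
generated by `f`. -/
noncomputable def relationFiltration (f : TensorAlgebra k V) : ℕ → Submodule k (TensorAlgebra k V)
  | 0 => ⊥
  | n + 1 => ⊤ * Submodule.span k {f} ⊔ relationFiltration f n * degreeOne k V

theorem relationFiltration_mono (f : TensorAlgebra k V) : Monotone (relationFiltration f) := by
  refine monotone_nat_of_le_succ fun n => ?_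
  induction n with
  | zero => exact bot_le
  | succ n ih => exact sup_le_sup le_rfl (mul_le_mul' ih le_rfl)

theorem mul_mem_relationFiltration_left {f x : TensorAlgebra k V} {n : ℕ} (a : TensorAlgebra k V)
    (hx : x ∈ relationFiltration f n) : a * x ∈ relationFiltration f n := by
  suffices h : ∀ n, ⊤ * relationFiltration f n ≤ relationFiltration f n from
    h n (Submodule.mul_mem_mul Submodule.mem_top hx)
  intro n
  induction n with
  | zero => simp [relationFiltration]
  | succ n ih =>
    rw [relationFiltration, Submodule.mul_sup, ← mul_assoc, ← mul_assoc]
    exact sup_le_sup (mul_le_mul' le_top le_rfl) (mul_le_mul' ih le_rfl)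

theorem mul_mem_relationFiltration_right {f x : TensorAlgebra k V} {n : ℕ} (a : TensorAlgebra k V)
    (hx : x ∈ relationFiltration f n) : ∃ m, x * a ∈ relationFiltration f m := by
  induction a using TensorAlgebra.induction generalizing x n with
  | algebraMap r =>
    refine ⟨n, ?_⟩
    rw [← Algebra.commutes, ← Algebra.smul_def]
    exact Submodule.smul_mem _ _ hx
  | ι w => exact ⟨n + 1, Submodule.mem_sup_right
      (Submodule.mul_mem_mul hx (LinearMap.mem_range_self _ w))⟩
  | mul a b ha hb =>
    obtain ⟨m, hm⟩ := ha hx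
    rw [← mul_assoc]
    exact hb hm
  | add a b ha hb =>
    obtain ⟨m, hm⟩ := ha hx
    obtain ⟨m', hm'⟩ := hb hx
    rw [mul_add]
    exact ⟨max m m', add_mem (relationFiltration_mono f (le_max_left _ _) hm)
      (relationFiltration_mono f (le_max_right _ _) hm')⟩

theorem mkRingHom_eq_zero_of_mem_relationFiltration {f x : TensorAlgebra k V} {n : ℕ}
    (hx : x ∈ relationFiltration f n) : RingQuot.mkRingHom (relOf f) x = 0 := by
  induction n generalizing x with
  | zero =>
    rw [(Submodule.mem_bot k).1 hx, map_zero]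
  | succ n ih =>
    obtain ⟨y, hy, z, hz, rfl⟩ := Submodule.mem_sup.1 hx
    obtain ⟨t, -, rfl⟩ := Submodule.mem_mul_span_singleton.1 hy
    have hf : RingQuot.mkRingHom (relOf f) f = 0 := by
      simpa using RingQuot.mkRingHom_rel (show relOf f f 0 from ⟨rfl, rfl⟩)
    rw [map_add, map_mul, hf, mul_zero, zero_add]
    clear hx hy
    induction hz using Submodule.mul_induction_on' with
    | mem_mul_mem p hp w hw => rw [map_mul, ih hp, zero_mul]
    | add x _ y _ hx hy => rw [map_add, hx, hy, add_zero]

theorem exists_mem_relationFiltration {f x : TensorAlgebra k V}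
    (hx : RingQuot.mkRingHom (relOf f) x = 0) : ∃ n, x ∈ relationFiltration f n := by
  let I : TwoSidedIdeal (TensorAlgebra k V) := TwoSidedIdeal.mk'
    {x | ∃ n, x ∈ relationFiltration f n} ⟨0, zero_mem _⟩
    (fun {x y} ⟨m, hm⟩ ⟨n, hn⟩ =>
      ⟨max m n, add_mem (relationFiltration_mono f (le_max_left _ _) hm)
        (relationFiltration_mono f (le_max_right _ _) hn)⟩)
    (fun {x} ⟨n, hn⟩ => ⟨n, neg_mem hn⟩)
    (fun {a x} ⟨n, hn⟩ => ⟨n, mul_mem_relationFiltration_left a hn⟩)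
    (fun {x a} ⟨n, hn⟩ => mul_mem_relationFiltration_right a hn)
  have hI : ∀ y, y ∈ I ↔ ∃ n, y ∈ relationFiltration f n := fun y => by
    simp [I, TwoSidedIdeal.mem_mk']
  have hker : ∀ ⦃a b : TensorAlgebra k V⦄, relOf f a b →
      I.ringCon.mk' a = I.ringCon.mk' b := by
    rintro a b ⟨rfl, rfl⟩
    refine (RingCon.eq _).2 ((I.mem_iff _).1 ((hI _).2 ⟨1, Submodule.mem_sup_left ?_⟩))
    exact Submodule.mem_mul_span_singleton.2 ⟨1, Submodule.mem_top, one_mul _⟩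
  have h := congrArg (RingQuot.lift ⟨_, hker⟩) hx
  rw [RingQuot.lift_mkRingHom_apply, map_zero] at h
  exact (hI x).1 ((I.mem_iff x).2 ((RingCon.eq _).1 h))

theorem mkRingHom_eq_zero_iff {f x : TensorAlgebra k V} :
    RingQuot.mkRingHom (relOf f) x = 0 ↔ ∃ n, x ∈ relationFiltration f n :=
  ⟨exists_mem_relationFiltration, fun ⟨_, hn⟩ => mkRingHom_eq_zero_of_mem_relationFiltration hn⟩

end RelationFiltration

section Quadratic

variable {k : Type*} [Field k] {V : Type*} [AddCommGroup V] [Module k V]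

theorem ι_eq_sum_basis {I : Type*} [Fintype I] (b : Module.Basis I k V) (w : V) :
    ι k w = ∑ i, b.repr w i • ι k (b i) := by
  simp_rw [← map_smul, ← map_sum, b.sum_repr]

theorem exists_eq_sum_ι_mul_ι_basis {I : Type*} [Fintype I] (b : Module.Basis I k V)
    {f : TensorAlgebra k V} (hf : f ∈ degreeOne k V * degreeOne k V) :
    ∃ u : I → V, f = ∑ i, ι k (u i) * ι k (b i) := by
  induction hf using Submodule.mul_induction_on' with
  | mem_mul_mem p hp w hw =>
    obtain ⟨p, rfl⟩ := hp
    obtain ⟨w, rfl⟩ := hw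
    refine ⟨fun i => b.repr w i • p, ?_⟩
    rw [ι_eq_sum_basis b w, Finset.mul_sum]
    simp
  | add x _ y _ hx hy =>
    obtain ⟨u, rfl⟩ := hx
    obtain ⟨u', rfl⟩ := hy
    exact ⟨u + u', by simp [add_mul, Finset.sum_add_distrib]⟩

theorem exists_rightContraction_eq_ι [FiniteDimensional k V] {f : TensorAlgebra k V}
    (hf : f ∈ degreeOne k V * degreeOne k V) (φ : V →ₗ[k] k) :
    ∃ w : V, rightContraction φ f = ι k w := by
  obtain ⟨u, rfl⟩ := exists_eq_sum_ι_mul_ι_basis (Module.finBasis k V) hf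
  exact ⟨∑ i, φ (Module.finBasis k V i) • u i, by simp [rightContraction_mul_ι]⟩

/-- A quadratic element that is not a product of vectors has a nonzero contraction by some linear
form vanishing on a given nonzero vector. -/
theorem exists_rightContraction_eq_ι_ne_zero [FiniteDimensional k V] {f : TensorAlgebra k V}
    (hf : f ∈ degreeOne k V * degreeOne k V) (hnp : ¬ ∃ u v : V, f = ι k u * ι k v)
    {v : V} (hv : v ≠ 0) :
    ∃ (φ : V →ₗ[k] k) (w : V), φ v = 0 ∧ w ≠ 0 ∧ rightContraction φ f = ι k w := by
  by_contra! hcon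
  let b := Module.finBasis k V
  obtain ⟨u, rfl⟩ := exists_eq_sum_ι_mul_ι_basis b hf
  let g : (V →ₗ[k] k) → V := fun φ => ∑ i, φ (b i) • u i
  have hg : ∀ φ : V →ₗ[k] k, φ v = 0 → g φ = 0 := fun φ hφ => by
    by_contra h
    exact hcon φ (g φ) hφ h (by simp [g, rightContraction_mul_ι])
  obtain ⟨φ₀, hφ₀⟩ := Module.Projective.exists_dual_ne_zero k hv
  have hu : ∀ i, u i = b.repr v i • (φ₀ v)⁻¹ • g φ₀ := fun i => by
    have h := hg (b.coord i - (b.repr v i * (φ₀ v)⁻¹) • φ₀) (by simp [hφ₀])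
    have hi : ∑ j, b.coord i (b j) • u j = u i := by
      simp [Finsupp.single_apply]
    simp only [g, LinearMap.sub_apply, LinearMap.smul_apply, sub_smul, Finset.sum_sub_distrib,
      hi, smul_assoc, ← Finset.smul_sum] at h
    rw [sub_eq_zero.1 h, mul_smul]
  refine hnp ⟨(φ₀ v)⁻¹ • g φ₀, v, ?_⟩
  rw [ι_eq_sum_basis b v, Finset.mul_sum]
  refine Finset.sum_congr rfl fun i _ => ?_
  rw [hu i, map_smul, smul_mul_assoc, mul_smul_comm]

theorem mem_relationFiltration_of_mul_ι_mem [FiniteDimensional k V] {f : TensorAlgebra k V}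
    (hf : f ∈ degreeOne k V * degreeOne k V) (hnp : ¬ ∃ u v : V, f = ι k u * ι k v)
    {v : V} (hv : v ≠ 0) {a : TensorAlgebra k V} {n : ℕ}
    (ha : a * ι k v ∈ relationFiltration f n) : a ∈ relationFiltration f n := by
  obtain ⟨φ₀, hφ₀⟩ := Module.Projective.exists_dual_ne_zero k hv
  induction n generalizing v a φ₀ with
  | zero =>
    have h := congrArg (rightContraction φ₀) ((Submodule.mem_bot k).1 ha)
    rw [rightContraction_mul_ι, map_zero] at h
    exact (Submodule.mem_bot k).2 ((smul_eq_zero.1 h).resolve_left hφ₀)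
  | succ n ih =>
    obtain ⟨y, hy, c, hc, hac⟩ := Submodule.mem_sup.1 ha
    obtain ⟨t, -, rfl⟩ := Submodule.mem_mul_span_singleton.1 hy
    have contract_mul : ∀ φ : V →ₗ[k] k,
        rightContraction φ (t * f) = t * rightContraction φ f := fun φ => by
      obtain ⟨u, rfl⟩ := exists_eq_sum_ι_mul_ι_basis (Module.finBasis k V) hf
      simp [Finset.mul_sum, ← mul_assoc, rightContraction_mul_ι]
    have contract : ∀ φ : V →ₗ[k] k,
        φ v • a = t * rightContraction φ f + rightContraction φ c := fun φ => by
      rw [← contract_mul, ← map_add, hac, rightContraction_mul_ι]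
    have hc' : ∀ φ : V →ₗ[k] k, rightContraction φ c ∈ relationFiltration f n := fun φ =>
      rightContraction_mem_of_mem_mul_degreeOne φ hc
    have ht : t ∈ relationFiltration f n := by
      obtain ⟨φ, w, hφ, hw, hfw⟩ := exists_rightContraction_eq_ι_ne_zero hf hnp hv
      obtain ⟨ψ, hψ⟩ := Module.Projective.exists_dual_ne_zero k hw
      refine ih hw ?_ ψ hψ
      have h := contract φ
      rw [hφ, zero_smul, hfw] at h
      rw [eq_neg_of_add_eq_zero_left h.symm]
      exact neg_mem (hc' φ)
    obtain ⟨w, hw⟩ := exists_rightContraction_eq_ι hf φ₀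
    rw [← Submodule.smul_mem_iff _ hφ₀, contract φ₀, hw]
    exact add_mem (Submodule.mem_sup_right (Submodule.mul_mem_mul ht (LinearMap.mem_range_self _ w)))
      (relationFiltration_mono f n.le_succ (hc' φ₀))

theorem mkRingHom_eq_zero_of_mul_ι [FiniteDimensional k V] {f : TensorAlgebra k V}
    (hf : f ∈ degreeOne k V * degreeOne k V) (hnp : ¬ ∃ u v : V, f = ι k u * ι k v)
    {v : V} (hv : v ≠ 0) {a : TensorAlgebra k V}
    (ha : RingQuot.mkRingHom (relOf f) (a * ι k v) = 0) :
    RingQuot.mkRingHom (relOf f) a = 0 := by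
  obtain ⟨n, hn⟩ := mkRingHom_eq_zero_iff.1 ha
  exact mkRingHom_eq_zero_iff.2 ⟨n, mem_relationFiltration_of_mul_ι_mem hf hnp hv hn⟩

end Quadratic

end TensorAlgebra

/-- If the quadratic element `f` is not a product of two degree-one elements
(i.e. its matrix of coefficients has rank `> 1`), then in the one-relation algebra
`A = T(V)/(f)` every nonzero element of `V` is neither a left nor a right
zero-divisor. -/
theorem single_quadratic_relation_no_zero_divisor
    {k : Type*} [Field k] {V : Type*} [AddCommGroup V] [Module k V]
    [FiniteDimensional k V]
    (f : TensorAlgebra k V) (hf2 : f ∈ degreeOne k V * degreeOne k V)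
    (hnp : ¬ ∃ u v : V, f = TensorAlgebra.ι k u * TensorAlgebra.ι k v)
    (v : V) (hv : v ≠ 0) (a : RingQuot (relOf f)) :
    (a * RingQuot.mkRingHom (relOf f) (TensorAlgebra.ι k v) = 0 → a = 0) ∧
    (RingQuot.mkRingHom (relOf f) (TensorAlgebra.ι k v) * a = 0 → a = 0) := by
  obtain ⟨a, rfl⟩ := RingQuot.mkRingHom_surjective (relOf f) a
  rw [← map_mul, ← map_mul]
  refine ⟨TensorAlgebra.mkRingHom_eq_zero_of_mul_ι hf2 hnp hv, fun h => ?_⟩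
  have hrev : ¬ ∃ u w : V, (TensorAlgebra.reverseOp f).unop =
      TensorAlgebra.ι k u * TensorAlgebra.ι k w := by
    rintro ⟨u, w, huw⟩
    refine hnp ⟨w, u, ?_⟩
    rw [← TensorAlgebra.unop_reverseOp_unop_reverseOp f, huw]
    simp
  have h' := TensorAlgebra.mkRingHom_unop_reverseOp_eq_zero h
  rw [map_mul, MulOpposite.unop_mul, TensorAlgebra.unop_reverseOp_ι] at h'
  have h'' := TensorAlgebra.mkRingHom_unop_reverseOp_eq_zero
    (TensorAlgebra.mkRingHom_eq_zero_of_mul_ι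
      (TensorAlgebra.unop_reverseOp_mem_degreeOne_mul hf2) hrev hv h')
  rwa [TensorAlgebra.unop_reverseOp_unop_reverseOp,
    TensorAlgebra.unop_reverseOp_unop_reverseOp] at h''
end

section
/- Let k be a field and V a finite-dimensional k-vector space of dimension n ≥ 1. Let f be a nonzero element of 𝒱·𝒱 and R := span_k{f}. Then (R · 𝒱) ⊓ (𝒱 · R) ≠ ⊥ if and only if there exist u ∈ V and c ∈ k with f = c • (ι(u)·ι(u)) (i.e. f is symmetric of rank 1). -/
namespace TensorAlgebra

section CommRing

variable {k : Type*} [CommRing k] {V : Type*} [AddCommGroup V] [Module k V]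

/-- The tensor algebra acting on two copies of itself, where `ι v` sends `(a, b)` to
`(ι v * a, φ v • a)`. -/
noncomputable def contractAction (φ : V →ₗ[k] k) :
    TensorAlgebra k V →ₐ[k] Module.End k (TensorAlgebra k V × TensorAlgebra k V) :=
  lift k <| LinearMap.mk₂ k (fun v p => (ι k v * p.1, φ v • p.1))
    (by intros; simp [add_mul, add_smul])
    (by intros; simp [mul_smul])
    (by intros; simp [mul_add])
    (by intro c v p; simp [smul_comm c (φ v)])

theorem contractAction_ι (φ : V →ₗ[k] k) (v : V) (p : TensorAlgebra k V × TensorAlgebra k V) :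
    contractAction φ (ι k v) p = (ι k v * p.1, φ v • p.1) := by
  simp [contractAction]

theorem contractAction_fst (φ : V →ₗ[k] k) (y : TensorAlgebra k V)
    (p : TensorAlgebra k V × TensorAlgebra k V) : (contractAction φ y p).1 = y * p.1 := by
  induction y using TensorAlgebra.induction generalizing p with
  | algebraMap r => simp [Algebra.smul_def]
  | ι v => simp [contractAction_ι]
  | mul a b ha hb => simp [ha, hb, mul_assoc]
  | add a b ha hb => simp [ha, hb, add_mul]

/-- Contraction of the leftmost tensor factor against a linear form. -/
noncomputable def contractFirst (φ : V →ₗ[k] k) : TensorAlgebra k V →ₗ[k] TensorAlgebra k V :=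
  LinearMap.snd k _ _ ∘ₗ LinearMap.applyₗ (1, 0) ∘ₗ (contractAction φ).toLinearMap

theorem contractFirst_ι_mul (φ : V →ₗ[k] k) (v : V) (y : TensorAlgebra k V) :
    contractFirst φ (ι k v * y) = φ v • y := by
  simp [contractFirst, contractAction_ι, contractAction_fst]

theorem exists_mul_ι_of_mem_span_singleton_mul {f x : TensorAlgebra k V}
    (hx : x ∈ Submodule.span k {f} * degreeOne k V) : ∃ v : V, x = f * ι k v := by
  induction hx using Submodule.mul_induction_on' with
  | mem_mul_mem m hm n hn =>
    obtain ⟨a, rfl⟩ := Submodule.mem_span_singleton.1 hm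
    obtain ⟨v, rfl⟩ := hn
    exact ⟨a • v, by simp⟩
  | add x _ y _ hx hy =>
    obtain ⟨v, rfl⟩ := hx
    obtain ⟨w, rfl⟩ := hy
    exact ⟨v + w, by simp [mul_add]⟩

theorem exists_ι_mul_of_mem_mul_span_singleton {f x : TensorAlgebra k V}
    (hx : x ∈ degreeOne k V * Submodule.span k {f}) : ∃ w : V, x = ι k w * f := by
  induction hx using Submodule.mul_induction_on' with
  | mem_mul_mem m hm n hn =>
    obtain ⟨a, rfl⟩ := Submodule.mem_span_singleton.1 hn
    obtain ⟨v, rfl⟩ := hm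
    exact ⟨a • v, by simp⟩
  | add x _ y _ hx hy =>
    obtain ⟨v, rfl⟩ := hx
    obtain ⟨w, rfl⟩ := hy
    exact ⟨v + w, by simp [add_mul]⟩

theorem exists_contractFirst_mul_eq_ι_mul (φ : V →ₗ[k] k) {f : TensorAlgebra k V}
    (hf : f ∈ degreeOne k V * degreeOne k V) :
    ∃ b : V, ∀ y, contractFirst φ (f * y) = ι k b * y := by
  induction hf using Submodule.mul_induction_on' with
  | mem_mul_mem m hm n hn =>
    obtain ⟨a, rfl⟩ := hm
    obtain ⟨b, rfl⟩ := hn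
    exact ⟨φ a • b, fun y => by simp [mul_assoc, contractFirst_ι_mul]⟩
  | add x _ y _ hx hy =>
    obtain ⟨v, hv⟩ := hx
    obtain ⟨w, hw⟩ := hy
    exact ⟨v + w, fun y => by simp [add_mul, hv, hw]⟩

end CommRing

section Field

variable {k : Type*} [Field k] {V : Type*} [AddCommGroup V] [Module k V]

theorem ι_mul_ne_zero {u : V} (hu : u ≠ 0) {y : TensorAlgebra k V} (hy : y ≠ 0) :
    ι k u * y ≠ 0 := by
  obtain ⟨φ, hφ⟩ := Module.Projective.exists_dual_ne_zero k hu
  intro h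
  have := contractFirst_ι_mul φ u y
  rw [h, map_zero] at this
  exact smul_ne_zero hφ hy this.symm

theorem exists_eq_smul_ι_mul_ι_of_mul_ι_eq_ι_mul {f : TensorAlgebra k V}
    (hf : f ∈ degreeOne k V * degreeOne k V) {v w : V} (hw : w ≠ 0)
    (h : f * ι k v = ι k w * f) : ∃ c : k, f = c • (ι k v * ι k v) := by
  obtain ⟨φ, hφ⟩ := Module.Projective.exists_dual_ne_zero k hw
  obtain ⟨b, hb⟩ := exists_contractFirst_mul_eq_ι_mul φ hf
  have hfb : φ w • f = ι k b * ι k v := by rw [← contractFirst_ι_mul, ← h, hb]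
  have hfv : φ w • (φ w • f) = φ b • (ι k v * ι k v) := by
    rw [← contractFirst_ι_mul, mul_smul_comm, ← h, ← smul_mul_assoc, hfb, mul_assoc,
      contractFirst_ι_mul]
  refine ⟨(φ w)⁻¹ * (φ w)⁻¹ * φ b, ?_⟩
  rw [mul_smul, ← hfv, smul_smul, smul_smul]
  field_simp
  simp

end Field

end TensorAlgebra

open TensorAlgebra in
/-- For a nonzero quadratic element `f` with `R = span {f}`, the overlap space
`(R·𝒱) ⊓ (𝒱·R)` is nonzero if and only if `f` is symmetric of rank one, i.e.
`f = c • (ι(u)·ι(u))` for some `u ∈ V`, `c ∈ k`. -/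
theorem quadratic_overlap_nonzero_iff_rank_one_symmetric
    {k : Type*} [Field k] {V : Type*} [AddCommGroup V] [Module k V]
    [FiniteDimensional k V] (hn : 1 ≤ Module.finrank k V)
    (f : TensorAlgebra k V) (hf0 : f ≠ 0) (hf2 : f ∈ degreeOne k V * degreeOne k V)
    (R : Submodule k (TensorAlgebra k V)) (hR : R = Submodule.span k {f}) :
    (R * degreeOne k V ⊓ degreeOne k V * R ≠ ⊥) ↔
      ∃ (u : V) (c : k), f = c • (TensorAlgebra.ι k u * TensorAlgebra.ι k u) := by
  subst hR
  rw [Submodule.ne_bot_iff]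
  constructor
  · rintro ⟨x, ⟨hxl, hxr⟩, hx⟩
    obtain ⟨v, hv⟩ := exists_mul_ι_of_mem_span_singleton_mul hxl
    obtain ⟨w, hw⟩ := exists_ι_mul_of_mem_mul_span_singleton hxr
    have hw0 : w ≠ 0 := by
      rintro rfl
      exact hx (by simpa using hw)
    exact ⟨v, exists_eq_smul_ι_mul_ι_of_mul_ι_eq_ι_mul hf2 hw0 (hv.symm.trans hw)⟩
  · rintro ⟨u, c, hu⟩
    have hu0 : u ≠ 0 := by
      rintro rfl
      exact hf0 (by simpa using hu)
    have hcomm : f * ι k u = ι k u * f := by simp [hu, mul_assoc]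
    have hfR := Submodule.mem_span_singleton_self (R := k) f
    have huV : ι k u ∈ degreeOne k V := ⟨u, rfl⟩
    exact ⟨ι k u * f, ⟨hcomm ▸ Submodule.mul_mem_mul hfR huV, Submodule.mul_mem_mul huV hfR⟩,
      ι_mul_ne_zero hu0 hf0⟩
end

section
/- Let k be a field and V a finite-dimensional k-vector space of dimension n. Let f ∈ 𝒱·𝒱 be a homogeneous quadratic element that is not a product ι(u)·ι(v) of two degree-one elements, and set R := span_k{f}. For m ≥ 2 let S_m := ⨆_{p+q=m−2} 𝒱^p · R · 𝒱^q, and S_0 = S_1 = ⊥. Define the integer sequence a : ℕ → ℤ by a_0 = 1, a_1 = n, and a_m = n·a_{m−1} − a_{m−2} for m ≥ 2. Then for every m ≥ 0, (finrank_k 𝒱^m) − (finrank_k S_m) = a_m (note finrank_k 𝒱^m = n^m). (Hilbert series H_A(t) = (1 − n t + t²)^{-1} for the one-relation quadratic algebra of global dimension 2.) -/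
namespace TensorAlgebra

open Module

section Contraction

variable {k : Type*} [Field k] {V : Type*} [AddCommGroup V] [Module k V]

/-- The algebra map `T(V) → End (T(V) × T(V))` determined by `v ↦ ((t, s) ↦ (v t, φ(v) t))`; its
second component at `(1, 0)` is the left contraction by `φ`. -/
noncomputable def contractLeftAux (φ : Dual k V) :
    TensorAlgebra k V →ₐ[k] End k (TensorAlgebra k V × TensorAlgebra k V) :=
  lift k
    { toFun := fun v =>
        (LinearMap.prod (LinearMap.mulLeft k (ι k v)) (φ v • LinearMap.id)) ∘ₗ
          LinearMap.fst k (TensorAlgebra k V) (TensorAlgebra k V)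
      map_add' := fun v w => by ext <;> simp [add_mul, add_smul]
      map_smul' := fun c v => by ext <;> simp [mul_smul] }

/-- Left contraction of tensors by a linear form: `ι v * t ↦ φ v • t`, and `1 ↦ 0`. -/
noncomputable def contractLeft (φ : Dual k V) : TensorAlgebra k V →ₗ[k] TensorAlgebra k V :=
  LinearMap.snd k _ _ ∘ₗ LinearMap.applyₗ (1, 0) ∘ₗ (contractLeftAux φ).toLinearMap

theorem contractLeftAux_ι_apply (φ : Dual k V) (v : V)
    (x : TensorAlgebra k V × TensorAlgebra k V) :
    contractLeftAux φ (ι k v) x = (ι k v * x.1, φ v • x.1) := by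
  simp [contractLeftAux]

theorem contractLeftAux_apply_fst (φ : Dual k V) (t : TensorAlgebra k V)
    (x : TensorAlgebra k V × TensorAlgebra k V) :
    (contractLeftAux φ t x).1 = t * x.1 := by
  induction t using TensorAlgebra.induction generalizing x with
  | algebraMap r => simp [Module.algebraMap_end_apply, Algebra.smul_def]
  | ι v => simp [contractLeftAux_ι_apply]
  | mul a b ha hb => simp [ha, hb, mul_assoc]
  | add a b ha hb => simp [ha, hb, add_mul]

theorem contractLeft_ι_mul (φ : Dual k V) (v : V) (t : TensorAlgebra k V) :
    contractLeft φ (ι k v * t) = φ v • t := by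
  simp [contractLeft, contractLeftAux_ι_apply, contractLeftAux_apply_fst]

theorem eq_zero_of_ι_mul_eq_zero {v : V} (hv : v ≠ 0) {t : TensorAlgebra k V} (h : ι k v * t = 0) :
    t = 0 := by
  obtain ⟨φ, hφ⟩ := Projective.exists_dual_eq_one k hv
  rw [← one_smul k t, ← hφ, ← contractLeft_ι_mul, h, map_zero]

/-- Elements of `𝒱 * P` are induced from the products `ι v * p`. -/
theorem degreeOne_mul_induction {P : Submodule k (TensorAlgebra k V)}
    {C : TensorAlgebra k V → Prop} (hmul : ∀ v, ∀ p ∈ P, C (ι k v * p))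
    (hadd : ∀ x y, C x → C y → C (x + y)) {t : TensorAlgebra k V} (ht : t ∈ degreeOne k V * P) :
    C t := by
  refine Submodule.mul_induction_on ht ?_ hadd
  rintro _ ⟨v, rfl⟩ p hp
  exact hmul v p hp

theorem ι_mem_degreeOne (v : V) : ι k v ∈ degreeOne k V := ⟨v, rfl⟩

theorem contractLeft_mem (φ : Dual k V) {P : Submodule k (TensorAlgebra k V)}
    {t : TensorAlgebra k V} (ht : t ∈ degreeOne k V * P) : contractLeft φ t ∈ P := by
  refine degreeOne_mul_induction (C := fun t => contractLeft φ t ∈ P) ?_ ?_ ht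
  · intro v p hp
    rw [contractLeft_ι_mul]
    exact P.smul_mem _ hp
  · intro x y hx hy
    rw [map_add]
    exact P.add_mem hx hy

theorem contractLeft_mul (φ : Dual k V) {P : Submodule k (TensorAlgebra k V)}
    {t : TensorAlgebra k V} (ht : t ∈ degreeOne k V * P) (s : TensorAlgebra k V) :
    contractLeft φ (t * s) = contractLeft φ t * s := by
  refine degreeOne_mul_induction
    (C := fun t => contractLeft φ (t * s) = contractLeft φ t * s) ?_ ?_ ht
  · intro v p _
    rw [mul_assoc, contractLeft_ι_mul, contractLeft_ι_mul, smul_mul_assoc]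
  · intro x y hx hy
    rw [add_mul, map_add, map_add, hx, hy, add_mul]

theorem contractLeft_sub_smul (φ ψ : Dual k V) (c : k) {P : Submodule k (TensorAlgebra k V)}
    {t : TensorAlgebra k V} (ht : t ∈ degreeOne k V * P) :
    contractLeft (ψ - c • φ) t = contractLeft ψ t - c • contractLeft φ t := by
  refine degreeOne_mul_induction
    (C := fun t => contractLeft (ψ - c • φ) t = contractLeft ψ t - c • contractLeft φ t) ?_ ?_ ht
  · intro v p _
    simp [contractLeft_ι_mul, sub_smul, mul_smul]
  · intro x y hx hy
    rw [map_add, map_add, map_add, hx, hy, smul_add]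
    abel

theorem sum_ι_mul_contractLeft {I : Type*} [Fintype I] (b : Basis I k V)
    {P : Submodule k (TensorAlgebra k V)} {t : TensorAlgebra k V} (ht : t ∈ degreeOne k V * P) :
    ∑ i, ι k (b i) * contractLeft (b.coord i) t = t := by
  refine degreeOne_mul_induction
    (C := fun t => ∑ i, ι k (b i) * contractLeft (b.coord i) t = t) ?_ ?_ ht
  · intro v p _
    conv_rhs => rw [← b.sum_repr v, map_sum, Finset.sum_mul]
    simp [contractLeft_ι_mul]
  · intro x y hx hy
    simp only [map_add, mul_add, Finset.sum_add_distrib, hx, hy]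

theorem finrank_degreeOne_mul [FiniteDimensional k V] (P : Submodule k (TensorAlgebra k V))
    [FiniteDimensional k P] :
    finrank k (degreeOne k V * P : Submodule k (TensorAlgebra k V)) =
      finrank k V * finrank k P := by
  classical
  let b := finBasis k V
  let F : (Fin (finrank k V) → P) →ₗ[k] TensorAlgebra k V :=
    ∑ i, LinearMap.mulLeft k (ι k (b i)) ∘ₗ P.subtype ∘ₗ LinearMap.proj i
  have hF (p) : F p = ∑ i, ι k (b i) * (p i : TensorAlgebra k V) := by
    simp [F, LinearMap.sum_apply]
  have hinj : Function.Injective F := by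
    refine (injective_iff_map_eq_zero F).2 fun p hp => ?_
    ext j
    have := congrArg (contractLeft (b.coord j)) hp
    simpa [hF, contractLeft_ι_mul, Finsupp.single_apply] using this
  have hrange : LinearMap.range F = degreeOne k V * P := by
    apply le_antisymm
    · rintro _ ⟨p, rfl⟩
      rw [hF]
      exact Submodule.sum_mem _ fun i _ => Submodule.mul_mem_mul (ι_mem_degreeOne _) (p i).2
    · intro t ht
      exact ⟨fun i => ⟨contractLeft (b.coord i) t, contractLeft_mem _ ht⟩, by
        rw [hF]; exact sum_ι_mul_contractLeft b ht⟩
  rw [← hrange, LinearMap.finrank_range_of_inj hinj, finrank_pi_fintype]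
  simp

instance finiteDimensional_degreeOne_pow [FiniteDimensional k V] (m : ℕ) :
    FiniteDimensional k (degreeOne k V ^ m : Submodule k (TensorAlgebra k V)) := by
  have h : (degreeOne k V).FG :=
    (Submodule.fg_iff_finiteDimensional _).2 (inferInstanceAs (FiniteDimensional k
      (LinearMap.range (ι k : V →ₗ[k] TensorAlgebra k V))))
  exact (Submodule.fg_iff_finiteDimensional _).1 (h.pow m)

theorem finrank_degreeOne_pow [FiniteDimensional k V] (m : ℕ) :
    finrank k (degreeOne k V ^ m : Submodule k (TensorAlgebra k V)) = finrank k V ^ m := by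
  induction m with
  | zero =>
    rw [pow_zero, pow_zero, Submodule.one_eq_span]
    exact finrank_span_singleton one_ne_zero
  | succ m ih => rw [pow_succ', finrank_degreeOne_mul, ih, pow_succ']

end Contraction

section Quadratic

variable {k : Type*} [Field k] {V : Type*} [AddCommGroup V] [Module k V]

/-- The homogeneous components of the two-sided ideal generated by a quadratic tensor `f`, by
recursion on the degree. -/
noncomputable def quadraticIdealPart (f : TensorAlgebra k V) :
    ℕ → Submodule k (TensorAlgebra k V)
  | 0 => ⊥
  | 1 => ⊥
  | m + 2 => Submodule.span k {f} * degreeOne k V ^ m ⊔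
      degreeOne k V * quadraticIdealPart f (m + 1)

theorem iSup_eq_quadraticIdealPart (f : TensorAlgebra k V) (m : ℕ) :
    ⨆ (p : ℕ × ℕ) (_ : p.1 + p.2 = m),
      degreeOne k V ^ p.1 * Submodule.span k {f} * degreeOne k V ^ p.2 =
    quadraticIdealPart f (m + 2) := by
  induction m with
  | zero =>
    rw [quadraticIdealPart, quadraticIdealPart, Submodule.mul_bot, sup_bot_eq]
    apply le_antisymm
    · refine iSup₂_le fun ⟨p, q⟩ h => ?_
      obtain ⟨rfl, rfl⟩ : p = 0 ∧ q = 0 := by simpa using h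
      simp
    · exact le_iSup₂_of_le (0, 0) rfl (by simp)
  | succ m ih =>
    rw [quadraticIdealPart, ← ih]
    apply le_antisymm
    · refine iSup₂_le fun ⟨p, q⟩ h => ?_
      cases p with
      | zero =>
        obtain rfl : q = m + 1 := by simpa using h
        exact le_sup_of_le_left (by simp)
      | succ p =>
        refine le_sup_of_le_right ?_
        rw [pow_succ', mul_assoc, mul_assoc, ← mul_assoc (degreeOne k V ^ p)]
        refine mul_le_mul_right ?_ _
        exact le_iSup₂_of_le (p, q) (by simp at h ⊢; omega) le_rfl
    · refine sup_le (le_iSup₂_of_le (0, m + 1) (by simp) (by simp)) ?_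
      simp only [Submodule.mul_iSup]
      refine iSup₂_le fun ⟨p, q⟩ h => ?_
      refine le_iSup₂_of_le (p + 1, q) (by simp at h ⊢; omega) ?_
      simp only [pow_succ', mul_assoc, le_refl]

theorem degreeOne_mul_quadraticIdealPart_le (f : TensorAlgebra k V) (m : ℕ) :
    degreeOne k V * quadraticIdealPart f m ≤ quadraticIdealPart f (m + 1) := by
  cases m with
  | zero => simp [quadraticIdealPart]
  | succ m => exact le_sup_right

variable {f : TensorAlgebra k V}

theorem quadraticIdealPart_le (hf : f ∈ degreeOne k V * degreeOne k V) (m : ℕ) :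
    quadraticIdealPart f m ≤ degreeOne k V ^ m := by
  induction m with
  | zero => exact bot_le
  | succ m ih =>
    cases m with
    | zero => exact bot_le
    | succ m =>
      refine sup_le ?_ ?_
      · rw [pow_succ', pow_succ', ← mul_assoc]
        exact mul_le_mul_left ((Submodule.span_singleton_le_iff_mem _ _).2 hf) _
      · rw [pow_succ']
        exact mul_le_mul_right ih _

theorem span_singleton_mul_eq_map (f : TensorAlgebra k V) (P : Submodule k (TensorAlgebra k V)) :
    Submodule.span k {f} * P = P.map (LinearMap.mulLeft k f) := by
  rw [Submodule.mul_eq_map₂, Submodule.map₂_span_singleton_eq_map]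
  rfl

/-- If every contraction of a quadratic tensor by a form vanishing at `ℓ` were zero, the tensor
would be a product with left factor `ι ℓ`. -/
theorem exists_contractLeft_eq_ι_of_not_product [FiniteDimensional k V]
    (hf : f ∈ degreeOne k V * degreeOne k V) (hnp : ¬ ∃ u v : V, f = ι k u * ι k v)
    (ℓ : V) (hℓ : ℓ ≠ 0) :
    ∃ ψ : Dual k V, ψ ℓ = 0 ∧ ∃ u : V, u ≠ 0 ∧ contractLeft ψ f = ι k u := by
  by_contra! H
  obtain ⟨φ, hφ⟩ := Projective.exists_dual_eq_one k hℓ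
  obtain ⟨w, hw⟩ := contractLeft_mem φ hf
  refine hnp ⟨ℓ, w, ?_⟩
  have key (ψ : Dual k V) : contractLeft ψ f = ψ ℓ • ι k w := by
    obtain ⟨u, hu⟩ := contractLeft_mem (ψ - ψ ℓ • φ) hf
    have h0 : u = 0 := by
      by_contra hu0
      exact H (ψ - ψ ℓ • φ) (by simp [hφ]) u hu0 hu.symm
    rw [h0, map_zero, contractLeft_sub_smul φ ψ _ hf, ← hw] at hu
    exact sub_eq_zero.1 hu.symm
  have hs := sum_ι_mul_contractLeft (finBasis k V) hf
  rw [← hs]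
  conv_rhs => rw [← (finBasis k V).sum_repr ℓ, map_sum, Finset.sum_mul]
  simp [key]

theorem exists_contractLeft_eq_ι [FiniteDimensional k V]
    (hf : f ∈ degreeOne k V * degreeOne k V) (hf0 : f ≠ 0) :
    ∃ (ψ : Dual k V) (u : V), u ≠ 0 ∧ contractLeft ψ f = ι k u := by
  by_contra! H
  refine hf0 ?_
  rw [← sum_ι_mul_contractLeft (finBasis k V) hf]
  refine Finset.sum_eq_zero fun i _ => ?_
  obtain ⟨u, hu⟩ := contractLeft_mem ((finBasis k V).coord i) hf
  have h0 : u = 0 := by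
    by_contra hu0
    exact H _ u hu0 hu.symm
  rw [← hu, h0, map_zero, mul_zero]

/-- Left multiplication by a nonzero degree-one element is injective on the quotient of the
tensor algebra by a quadratic relation which is not a product. -/
theorem mem_quadraticIdealPart_of_ι_mul_mem [FiniteDimensional k V]
    (hf : f ∈ degreeOne k V * degreeOne k V) (hnp : ¬ ∃ u v : V, f = ι k u * ι k v)
    (m : ℕ) {ℓ : V} (hℓ : ℓ ≠ 0) {g : TensorAlgebra k V}
    (h : ι k ℓ * g ∈ quadraticIdealPart f (m + 1)) : g ∈ quadraticIdealPart f m := by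
  induction m generalizing ℓ g with
  | zero => exact eq_zero_of_ι_mul_eq_zero hℓ h
  | succ m ih =>
    obtain ⟨x, hx, s, hs, hxs⟩ := Submodule.mem_sup.1 h
    rw [span_singleton_mul_eq_map] at hx
    obtain ⟨t, -, rfl⟩ := hx
    rw [LinearMap.mulLeft_apply] at hxs
    have hD (φ : Dual k V) : contractLeft φ f * t + contractLeft φ s = φ ℓ • g := by
      rw [← contractLeft_ι_mul, ← hxs, map_add, contractLeft_mul φ hf]
    obtain ⟨ψ, hψ, u, hu, hψf⟩ := exists_contractLeft_eq_ι_of_not_product hf hnp ℓ hℓ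
    have ht : t ∈ quadraticIdealPart f m := by
      refine ih hu ?_
      have h1 := hD ψ
      rw [hψ, zero_smul, hψf] at h1
      rw [eq_neg_of_add_eq_zero_left h1]
      exact Submodule.neg_mem _ (contractLeft_mem ψ hs)
    obtain ⟨φ, hφ⟩ := Projective.exists_dual_eq_one k hℓ
    have h2 := hD φ
    rw [hφ, one_smul] at h2
    rw [← h2]
    exact Submodule.add_mem _ (degreeOne_mul_quadraticIdealPart_le f m
      (Submodule.mul_mem_mul (contractLeft_mem φ hf) ht)) (contractLeft_mem φ hs)

theorem mulLeft_injective_of_quadratic [FiniteDimensional k V]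
    (hf : f ∈ degreeOne k V * degreeOne k V) (hf0 : f ≠ 0) :
    Function.Injective (LinearMap.mulLeft k f) := by
  obtain ⟨ψ, u, hu, hψ⟩ := exists_contractLeft_eq_ι hf hf0
  refine (injective_iff_map_eq_zero _).2 fun g hg => eq_zero_of_ι_mul_eq_zero hu ?_
  rw [← hψ, ← contractLeft_mul ψ hf, ← LinearMap.mulLeft_apply k f g, hg, map_zero]

theorem span_mul_inf_eq_map [FiniteDimensional k V]
    (hf : f ∈ degreeOne k V * degreeOne k V) (hnp : ¬ ∃ u v : V, f = ι k u * ι k v) (m : ℕ) :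
    Submodule.span k {f} * degreeOne k V ^ m ⊓ degreeOne k V * quadraticIdealPart f (m + 1) =
      (quadraticIdealPart f m).map (LinearMap.mulLeft k f) := by
  have hf0 : f ≠ 0 := fun h => hnp ⟨0, 0, by simp [h]⟩
  rw [span_singleton_mul_eq_map]
  apply le_antisymm
  · rintro _ ⟨⟨g, -, rfl⟩, hg⟩
    refine ⟨g, ?_, rfl⟩
    obtain ⟨ψ, u, hu, hψ⟩ := exists_contractLeft_eq_ι hf hf0
    refine mem_quadraticIdealPart_of_ι_mul_mem hf hnp m hu ?_
    rw [← hψ, ← contractLeft_mul ψ hf]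
    exact contractLeft_mem ψ hg
  · refine le_inf (Submodule.map_mono (quadraticIdealPart_le hf m)) ?_
    rw [← span_singleton_mul_eq_map]
    calc Submodule.span k {f} * quadraticIdealPart f m
        ≤ degreeOne k V * degreeOne k V * quadraticIdealPart f m :=
          mul_le_mul_left ((Submodule.span_singleton_le_iff_mem _ _).2 hf) _
      _ ≤ degreeOne k V * quadraticIdealPart f (m + 1) := by
          rw [mul_assoc]
          exact mul_le_mul_right (degreeOne_mul_quadraticIdealPart_le f m) _

theorem finrank_quadraticIdealPart_add [FiniteDimensional k V]
    (hf : f ∈ degreeOne k V * degreeOne k V) (hnp : ¬ ∃ u v : V, f = ι k u * ι k v) (m : ℕ) :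
    finrank k (quadraticIdealPart f (m + 2)) + finrank k (quadraticIdealPart f m) =
      finrank k V ^ m + finrank k V * finrank k (quadraticIdealPart f (m + 1)) := by
  have hf0 : f ≠ 0 := fun h => hnp ⟨0, 0, by simp [h]⟩
  have hfin (j : ℕ) : FiniteDimensional k (quadraticIdealPart f j) :=
    Submodule.finiteDimensional_of_le (quadraticIdealPart_le hf j)
  have hmap (P : Submodule k (TensorAlgebra k V)) :
      finrank k (P.map (LinearMap.mulLeft k f)) = finrank k P :=
    (Submodule.equivMapOfInjective _ (mulLeft_injective_of_quadratic hf hf0) P).finrank_eq.symm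
  have hle := quadraticIdealPart_le hf (m + 2)
  have h1 : FiniteDimensional k
      (Submodule.span k {f} * degreeOne k V ^ m : Submodule k (TensorAlgebra k V)) :=
    Submodule.finiteDimensional_of_le (le_sup_left.trans hle)
  have h2 : FiniteDimensional k
      (degreeOne k V * quadraticIdealPart f (m + 1) : Submodule k (TensorAlgebra k V)) :=
    Submodule.finiteDimensional_of_le (le_sup_right.trans hle)
  have h := Submodule.finrank_sup_add_finrank_inf_eq
    (Submodule.span k {f} * degreeOne k V ^ m) (degreeOne k V * quadraticIdealPart f (m + 1))
  rwa [span_mul_inf_eq_map hf hnp, hmap, finrank_degreeOne_mul, span_singleton_mul_eq_map, hmap,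
    finrank_degreeOne_pow, ← span_singleton_mul_eq_map] at h

end Quadratic

end TensorAlgebra

/-- **Hilbert series `H_A(t) = (1 - n t + t²)⁻¹`.** For a quadratic element `f` that is
not a product of two degree-one elements, `R = span {f}`, and
`S_m = ⨆_{p+q=m-2} 𝒱^p·R·𝒱^q` the degree-`m` part of the ideal generated by `f`, the
dimensions `a_m = dim 𝒱^m - dim S_m` of the quotient algebra satisfy `a_0 = 1`,
`a_1 = n` and `a_m = n·a_{m-1} - a_{m-2}`. -/
theorem single_quadratic_relation_hilbert_series
    {k : Type*} [Field k] {V : Type*} [AddCommGroup V] [Module k V]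
    [FiniteDimensional k V]
    (n : ℕ) (hn : Module.finrank k V = n)
    (f : TensorAlgebra k V) (hf2 : f ∈ degreeOne k V * degreeOne k V)
    (hnp : ¬ ∃ u v : V, f = TensorAlgebra.ι k u * TensorAlgebra.ι k v)
    (R : Submodule k (TensorAlgebra k V)) (hR : R = Submodule.span k {f})
    (S : ℕ → Submodule k (TensorAlgebra k V))
    (hS0 : S 0 = ⊥) (hS1 : S 1 = ⊥)
    (hS : ∀ m : ℕ, 2 ≤ m → S m = ⨆ (p : ℕ × ℕ) (_ : p.1 + p.2 = m - 2),
        (degreeOne k V) ^ p.1 * R * (degreeOne k V) ^ p.2)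
    (a : ℕ → ℤ) (ha0 : a 0 = 1) (ha1 : a 1 = n)
    (harec : ∀ m : ℕ, 2 ≤ m → a m = n * a (m - 1) - a (m - 2)) :
    ∀ m : ℕ, (Module.finrank k ((degreeOne k V) ^ m : Submodule k (TensorAlgebra k V)) : ℤ)
        - (Module.finrank k (S m) : ℤ) = a m := by
  subst hn hR
  have hSm (m : ℕ) : S m = TensorAlgebra.quadraticIdealPart f m := by
    match m with
    | 0 => exact hS0
    | 1 => exact hS1
    | m + 2 => rw [hS _ (by omega), Nat.add_sub_cancel, TensorAlgebra.iSup_eq_quadraticIdealPart]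
  intro m
  rw [hSm, TensorAlgebra.finrank_degreeOne_pow]
  induction m using Nat.twoStepInduction with
  | zero => rw [TensorAlgebra.quadraticIdealPart, finrank_bot, ha0]; simp
  | one => rw [TensorAlgebra.quadraticIdealPart, finrank_bot, ha1]; simp
  | more m ih₀ ih₁ =>
    have h := TensorAlgebra.finrank_quadraticIdealPart_add hf2 hnp m
    rw [harec _ (by omega), Nat.add_sub_cancel, show m + 2 - 1 = m + 1 from rfl, ← ih₀, ← ih₁]
    zify at h
    push_cast
    linear_combination -h
end

section
/- Let α be a finite type with n elements and w : List α a list of length N ≥ 2 that has no nontrivial self-overlap: for every m with 1 ≤ m ≤ N−1 there exist no lists u, v of length m with w ++ u = v ++ w. For i : ℕ let a_i denote the number of lists over α of length i that do not contain w as an infix (contiguous factor). Then a_i = n^i for 0 ≤ i ≤ N−1, and a_i = n·a_{i−1} − a_{i−N} for every i ≥ N. (Numerical Hilbert series combinatorics: the number of monomials avoiding the factor w satisfies the recursion coming from H_A(t) = (1 − n t + t^N)^{-1}.) -/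
/-- The words of length `i` over `α` that do not contain `w` as an infix. -/
def avoidingWords {α : Type*} (w : List α) (i : ℕ) : Set (List α) :=
  {l | l.length = i ∧ ¬ w <:+: l}

theorem finite_avoidingWords {α : Type*} [Finite α] (w : List α) (i : ℕ) :
    (avoidingWords w i).Finite :=
  (List.finite_length_eq α i).subset fun _ hl => hl.1

theorem ncard_avoidingWords_of_lt_length {α : Type*} [Fintype α] {w : List α} {i : ℕ}
    (hi : i < w.length) : (avoidingWords w i).ncard = Fintype.card α ^ i := by
  have h : avoidingWords w i = {l : List α | l.length = i} := by
    ext l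
    refine and_iff_left_of_imp fun hl hwl => ?_
    have := hwl.length_le
    omega
  rw [h, ← card_vector (α := α) i, ← Nat.card_eq_fintype_card]
  rfl

/-- If `w` has no nontrivial self-overlap and `r` avoids `w`, then `w` occurs in `w ++ r`
only as a prefix. -/
theorem eq_nil_of_append_append_eq {α : Type*} {w r v t : List α}
    (hno : ∀ m : ℕ, 1 ≤ m → m ≤ w.length - 1 →
      ¬ ∃ u v : List α, u.length = m ∧ v.length = m ∧ w ++ u = v ++ w)
    (hr : ¬ w <:+: r) (h : v ++ w ++ t = w ++ r) : v = [] := by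
  by_contra hv
  have hpos := List.length_pos_iff.2 hv
  rcases lt_or_ge v.length w.length with hlt | hge
  · have hpre : w <+: v ++ w :=
      List.prefix_of_prefix_length_le ⟨r, rfl⟩ ⟨t, h⟩ (by simp)
    obtain ⟨u, hu⟩ := hpre
    refine hno v.length hpos (by omega) ⟨u, v, ?_, rfl, hu⟩
    have := congrArg List.length hu
    simp only [List.length_append] at this
    omega
  · have hpre : w <+: v :=
      List.prefix_of_prefix_length_le ⟨r, rfl⟩ ⟨w ++ t, by simpa using h⟩ hge
    obtain ⟨s, rfl⟩ := hpre
    exact hr ⟨s, t, by simpa using h⟩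

/-- Prepending a letter to a word avoiding `w` yields either a word avoiding `w` or `w` followed
by a word avoiding `w`. -/
theorem image_cons_avoidingWords {α : Type*} {w : List α} (hw : w ≠ [])
    (hno : ∀ m : ℕ, 1 ≤ m → m ≤ w.length - 1 →
      ¬ ∃ u v : List α, u.length = m ∧ v.length = m ∧ w ++ u = v ++ w)
    {i : ℕ} (hi : w.length ≤ i + 1) :
    (fun p : α × List α => p.1 :: p.2) '' (Set.univ ×ˢ avoidingWords w i) =
      avoidingWords w (i + 1) ∪ (w ++ ·) '' avoidingWords w (i + 1 - w.length) := by
  ext l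
  constructor
  · rintro ⟨⟨x, l⟩, ⟨-, hlen, hl⟩, rfl⟩
    dsimp only at hlen hl ⊢
    by_cases hx : w <:+: x :: l
    · right
      rcases List.infix_cons_iff.1 hx with ⟨r, hr⟩ | h
      · refine ⟨r, ⟨?_, fun hwr => hl ?_⟩, hr⟩
        · have := congrArg List.length hr
          simp only [List.length_append, List.length_cons] at this
          omega
        · obtain ⟨y, w', rfl⟩ := List.exists_cons_of_ne_nil hw
          obtain ⟨-, rfl⟩ := List.cons.inj hr
          exact hwr.trans (List.suffix_append w' r).isInfix
      · exact absurd h hl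
    · exact Or.inl ⟨by simp [hlen], hx⟩
  · rintro (⟨hlen, hl⟩ | ⟨r, ⟨hlen, hr⟩, rfl⟩)
    · obtain ⟨x, l, rfl⟩ := List.exists_cons_of_length_eq_add_one hlen
      exact ⟨(x, l), ⟨trivial, by simpa using hlen,
        fun h => hl (List.infix_cons h)⟩, rfl⟩
    · obtain ⟨y, w', hyw⟩ := List.exists_cons_of_ne_nil hw
      refine ⟨(y, w' ++ r), ⟨trivial, ?_, ?_⟩, by simp [hyw]⟩
      · have := congrArg List.length hyw
        simp only [List.length_append, List.length_cons] at this ⊢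
        omega
      · rintro ⟨s, t, hst⟩
        exact List.cons_ne_nil y s
          (eq_nil_of_append_append_eq (t := t) hno hr (by simpa [hyw] using hst))

theorem ncard_avoidingWords_succ_add {α : Type*} [Fintype α] {w : List α} (hw : w ≠ [])
    (hno : ∀ m : ℕ, 1 ≤ m → m ≤ w.length - 1 →
      ¬ ∃ u v : List α, u.length = m ∧ v.length = m ∧ w ++ u = v ++ w)
    {i : ℕ} (hi : w.length ≤ i + 1) :
    (avoidingWords w (i + 1)).ncard + (avoidingWords w (i + 1 - w.length)).ncard =
      Fintype.card α * (avoidingWords w i).ncard := by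
  have hdisj : Disjoint (avoidingWords w (i + 1))
      ((w ++ ·) '' avoidingWords w (i + 1 - w.length)) := by
    rw [Set.disjoint_left]
    rintro _ ⟨-, hl⟩ ⟨r, -, rfl⟩
    exact hl (List.prefix_append w r).isInfix
  have hcons : Function.Injective fun p : α × List α => p.1 :: p.2 := by
    rintro ⟨x, l⟩ ⟨y, m⟩ h
    simpa using h
  rw [← Set.ncard_image_of_injective (avoidingWords w (i + 1 - w.length))
      (List.append_right_injective w),
    ← Set.ncard_union_eq hdisj (finite_avoidingWords w _) ((finite_avoidingWords w _).image _),
    ← image_cons_avoidingWords hw hno hi, Set.ncard_image_of_injective _ hcons, Set.ncard_prod,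
    Set.ncard_univ, Nat.card_eq_fintype_card]

/-- **Numerical Hilbert series combinatorics for a single monomial relation.**
Over an alphabet with `n` letters, let `w` be a word of length `N ≥ 2` with no
nontrivial self-overlap. Then the numbers `a_i` of words of length `i` not containing
`w` as an infix satisfy `a_i = n^i` for `i ≤ N-1` and `a_i = n·a_{i-1} - a_{i-N}`
for `i ≥ N`. -/
theorem avoiding_words_count_recursion
    {α : Type*} [Fintype α] (n : ℕ) (hcard : Fintype.card α = n)
    (w : List α) (N : ℕ) (hN : 2 ≤ N) (hw : w.length = N)
    (hno : ∀ m : ℕ, 1 ≤ m → m ≤ N - 1 →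
        ¬ ∃ u v : List α, u.length = m ∧ v.length = m ∧ w ++ u = v ++ w)
    (a : ℕ → ℕ)
    (ha : ∀ i : ℕ, a i = Nat.card {l : List α // l.length = i ∧ ¬ w <:+: l}) :
    (∀ i : ℕ, i ≤ N - 1 → a i = n ^ i) ∧
    (∀ i : ℕ, N ≤ i → (a i : ℤ) = n * a (i - 1) - a (i - N)) := by
  subst hcard hw
  obtain rfl : a = fun i => (avoidingWords w i).ncard := funext ha
  have hne : w ≠ [] := List.ne_nil_of_length_pos (by omega)
  refine ⟨fun i hi => ncard_avoidingWords_of_lt_length (by omega), fun i hi => ?_⟩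
  obtain ⟨j, rfl⟩ : ∃ j, i = j + 1 := ⟨i - 1, by omega⟩
  rw [eq_sub_iff_add_eq]
  exact_mod_cast ncard_avoidingWords_succ_add hne hno hi
end
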